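/- arXiv:2410.23152 — 7 statements merged into one kernel-verified Lean document; each statement's English description precedes it below -/
import Mathlib

section
/- In the two-qubit entanglement swapping setup, with p0 := |a0·b0|² + |a1·b1|² and p1 := |a0·b1|² + |a1·b0|², the average post-measurement entropy satisfies ∑_{i : p_i>0} p_i · S(ρ^i) ≤ p0 · h(|a0·b0|²/p0) + p1 · h(|a0·b1|²/p1), where a summand on the right-hand side is read as 0 when the corresponding p0 or p1 vanishes. -/
open Classical

/-- Von Neumann entropy (natural log) of a matrix, via the eigenvalues of a
Hermitian matrix; junk value 0 for non-Hermitian matrices. -/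
noncomputable def vnEntropy {n : Type*} [Fintype n] [DecidableEq n] (ρ : Matrix n n ℂ) : ℝ :=
  if h : ρ.IsHermitian then ∑ i, Real.negMulLog (h.eigenvalues i) else 0

/-- Binary entropy h(t) = −t ln t − (1−t) ln(1−t). -/
noncomputable def binEnt (t : ℝ) : ℝ := Real.negMulLog t + Real.negMulLog (1 - t)

/-- The entropy of a two-qubit pure state as a function of its concurrence. -/
noncomputable def concurrenceEntropy (x : ℝ) : ℝ :=
  Real.binEntropy ((1 + √(1 - x ^ 2)) / 2)

lemma binEnt_eq_binEntropy (t : ℝ) : binEnt t = Real.binEntropy t :=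
  (Real.binEntropy_eq_negMulLog_add_negMulLog_one_sub t).symm

lemma concurrenceEntropy_two_mul_sqrt {e d : ℝ} (hd : 0 ≤ d) (h : e * (1 - e) = d) :
    concurrenceEntropy (2 * √d) = Real.binEntropy e := by
  have h1 : 1 - (2 * √d) ^ 2 = (2 * e - 1) ^ 2 := by
    rw [mul_pow, Real.sq_sqrt hd, ← h]; ring
  rw [concurrenceEntropy, h1, Real.sqrt_sq_eq_abs]
  rcases abs_choice (2 * e - 1) with h2 | h2 <;> rw [h2]
  · congr 1; ring
  · rw [← Real.binEntropy_one_sub]; congr 1; ring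

lemma monotoneOn_concurrenceEntropy : MonotoneOn concurrenceEntropy (Set.Icc 0 1) := by
  intro x hx y hy hxy
  have hmem (z : ℝ) : (1 + √(1 - z ^ 2)) / 2 ∈ Set.Icc (2⁻¹ : ℝ) 1 := by
    have h0 := Real.sqrt_nonneg (1 - z ^ 2)
    have h1 : √(1 - z ^ 2) ≤ 1 := Real.sqrt_le_one.mpr (by nlinarith [sq_nonneg z])
    constructor <;> linarith
  refine Real.binEntropy_strictAntiOn.antitoneOn (hmem y) (hmem x) ?_
  have : x ^ 2 ≤ y ^ 2 := pow_le_pow_left₀ hx.1 hxy 2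
  gcongr

lemma le_half_log_sub_log {s : ℝ} (h0 : 0 ≤ s) (h1 : s < 1) :
    s ≤ (Real.log (1 + s) - Real.log (1 - s)) / 2 := by
  have h := Real.sum_range_le_log_div h0 h1 1
  rw [Real.log_div (by linarith) (by linarith)] at h
  simp at h
  linarith

lemma convexOn_concurrenceEntropy : ConvexOn ℝ (Set.Icc 0 1) concurrenceEntropy := by
  have hs (x : ℝ) (hx : x ∈ Set.Ioo (0 : ℝ) 1) :
      0 < √(1 - x ^ 2) ∧ √(1 - x ^ 2) < 1 ∧ √(1 - x ^ 2) ^ 2 = 1 - x ^ 2 := by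
    have h1 : 0 < 1 - x ^ 2 := by nlinarith [hx.1, hx.2]
    refine ⟨Real.sqrt_pos.2 h1, ?_, Real.sq_sqrt h1.le⟩
    rw [Real.sqrt_lt' one_pos]
    nlinarith [hx.1]
  have hds (x : ℝ) (hx : x ∈ Set.Ioo (0 : ℝ) 1) :
      HasDerivAt (fun x : ℝ => √(1 - x ^ 2)) (-x / √(1 - x ^ 2)) x := by
    obtain ⟨h0, -, -⟩ := hs x hx
    refine (((hasDerivAt_pow 2 x).const_sub 1).sqrt (Real.sqrt_pos.1 h0).ne').congr_deriv ?_
    field_simp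
    norm_num
  refine convexOn_of_hasDerivWithinAt2_nonneg (convex_Icc 0 1)
    (f' := fun x => x * ((Real.log (1 + √(1 - x ^ 2)) - Real.log (1 - √(1 - x ^ 2))) / 2)
      / √(1 - x ^ 2))
    (f'' := fun x => ((Real.log (1 + √(1 - x ^ 2)) - Real.log (1 - √(1 - x ^ 2))) / 2
      - √(1 - x ^ 2)) / √(1 - x ^ 2) ^ 3) ?_ ?_ ?_ ?_
  · unfold concurrenceEntropy
    fun_prop
  all_goals
    rw [interior_Icc]
    intro x hx
    obtain ⟨h0, h1, h2⟩ := hs x hx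
    have hd := hds x hx
  · have hb := Real.hasDerivAt_binEntropy (p := (1 + √(1 - x ^ 2)) / 2)
      (by linarith) (by linarith)
    refine ((hb.comp x ((hd.const_add 1).div_const 2)).congr_deriv ?_).hasDerivWithinAt
    rw [show 1 - (1 + √(1 - x ^ 2)) / 2 = (1 - √(1 - x ^ 2)) / 2 by ring,
      Real.log_div (by linarith) two_ne_zero, Real.log_div (by linarith) two_ne_zero]
    field_simp
    ring
  · have hl := (((hd.const_add 1).log (by linarith)).sub
      ((hd.const_sub 1).log (by linarith))).div_const 2
    refine ((((hasDerivAt_id x).mul hl).div hd h0.ne').congr_deriv ?_).hasDerivWithinAt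
    have h3 : 1 + √(1 - x ^ 2) ≠ 0 := by linarith
    have h4 : 1 - √(1 - x ^ 2) ≠ 0 := by linarith
    have h5 : x ^ 2 = 1 - √(1 - x ^ 2) ^ 2 := by linarith
    simp only [id, Pi.sub_apply, Pi.mul_apply]
    generalize √(1 - x ^ 2) = s at *
    field_simp
    grind
  · have := le_half_log_sub_log h0.le h1
    exact div_nonneg (by linarith) (by positivity)

lemma mul_binEntropy_div_eq {A B : ℝ} (hA : 0 ≤ A) (hB : 0 ≤ B) :
    (A + B) * Real.binEntropy (A / (A + B)) =
      (A + B) * concurrenceEntropy (2 * √(A * B) / (A + B)) := by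
  rcases (add_nonneg hA hB).eq_or_lt with h | h
  · simp [← h]
  · rw [← concurrenceEntropy_two_mul_sqrt (e := A / (A + B)) (d := A * B / (A + B) ^ 2)
      (by positivity) (by field_simp; ring), Real.sqrt_div (by positivity), Real.sqrt_sq h.le,
      mul_div_assoc]

lemma two_mul_sqrt_div_mem_Icc {A B : ℝ} (hA : 0 ≤ A) (hB : 0 ≤ B) :
    2 * √(A * B) / (A + B) ∈ Set.Icc (0 : ℝ) 1 := by
  refine ⟨by positivity, div_le_one_of_le₀ ?_ (by positivity)⟩
  rw [Real.sqrt_mul hA]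
  nlinarith [sq_nonneg (√A - √B), Real.sq_sqrt hA, Real.sq_sqrt hB]

/-- The entropy of a pure state splits subadditively into its even- and odd-parity parts. -/
lemma mul_concurrenceEntropy_div_le {A B C D c : ℝ} (hA : 0 ≤ A) (hB : 0 ≤ B) (hC : 0 ≤ C)
    (hD : 0 ≤ D) (hc : 0 ≤ c) (hle : c ≤ 2 * √(A * B) + 2 * √(C * D))
    (hpos : 0 < A + B + (C + D)) :
    (A + B + (C + D)) * concurrenceEntropy (c / (A + B + (C + D))) ≤
      (A + B) * Real.binEntropy (A / (A + B)) + (C + D) * Real.binEntropy (C / (C + D)) := by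
  rw [mul_binEntropy_div_eq hA hB, mul_binEntropy_div_eq hC hD]
  set p := A + B + (C + D) with hp
  have hAB := two_mul_sqrt_div_mem_Icc hA hB
  have hCD := two_mul_sqrt_div_mem_Icc hC hD
  have hw : (A + B) / p + (C + D) / p = 1 := by rw [← add_div, div_self hpos.ne']
  have hw1 : 0 ≤ (A + B) / p := by positivity
  have hw2 : 0 ≤ (C + D) / p := by positivity
  have key := convexOn_concurrenceEntropy.2 hAB hCD hw1 hw2 hw
  have hmem := convexOn_concurrenceEntropy.1 hAB hCD hw1 hw2 hw
  have hcancel {X Y : ℝ} (hX : 0 ≤ X) (hY : 0 ≤ Y) :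
      (X + Y) / p * (2 * √(X * Y) / (X + Y)) = 2 * √(X * Y) / p := by
    rcases (add_nonneg hX hY).eq_or_lt with h | h
    · have : X = 0 := by linarith
      simp [this]
    · field_simp
  simp only [smul_eq_mul] at key hmem
  rw [hcancel hA hB, hcancel hC hD, ← add_div] at key hmem
  have hcp : c / p ≤ (2 * √(A * B) + 2 * √(C * D)) / p := by gcongr
  have hmono := monotoneOn_concurrenceEntropy
    ⟨div_nonneg hc hpos.le, hcp.trans hmem.2⟩ hmem hcp
  calc p * concurrenceEntropy (c / p) ≤ p * _ :=
        mul_le_mul_of_nonneg_left (hmono.trans key) hpos.le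
    _ = _ := by field_simp

lemma vnEntropy_fin_two {M : Matrix (Fin 2) (Fin 2) ℂ} (hM : M.IsHermitian) {d : ℝ}
    (hd : 0 ≤ d) (htr : M.trace = 1) (hdet : M.det = d) :
    vnEntropy M = concurrenceEntropy (2 * √d) := by
  rw [hM.trace_eq_sum_eigenvalues, Fin.sum_univ_two] at htr
  rw [hM.det_eq_prod_eigenvalues, Fin.prod_univ_two] at hdet
  have h1 : hM.eigenvalues 1 = 1 - hM.eigenvalues 0 := by
    rw [eq_sub_iff_add_eq']; exact Complex.ofReal_injective (by simpa using htr)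
  have h2 : hM.eigenvalues 0 * hM.eigenvalues 1 = d := Complex.ofReal_injective (by simpa using hdet)
  rw [vnEntropy, dif_pos hM, Fin.sum_univ_two, h1,
    ← Real.binEntropy_eq_negMulLog_add_negMulLog_one_sub,
    concurrenceEntropy_two_mul_sqrt hd (by rw [← h1, h2])]

lemma sum_mul_binEntropy_div_le {ι : Type*} (s : Finset ι) {A B : ι → ℝ}
    (hA : ∀ i, 0 ≤ A i) (hB : ∀ i, 0 ≤ B i) :
    ∑ i ∈ s, (A i + B i) * Real.binEntropy (A i / (A i + B i)) ≤
      (∑ i ∈ s, A i + ∑ i ∈ s, B i) *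
        Real.binEntropy ((∑ i ∈ s, A i) / (∑ i ∈ s, A i + ∑ i ∈ s, B i)) := by
  have hAB (i : ι) : 0 ≤ A i + B i := add_nonneg (hA i) (hB i)
  rw [← Finset.sum_add_distrib]
  set P := ∑ i ∈ s, (A i + B i) with hP
  rcases (Finset.sum_nonneg fun i (_ : i ∈ s) => hAB i).eq_or_lt with h | h
  · rw [← hP] at h
    have h0 := (Finset.sum_eq_zero_iff_of_nonneg fun i (_ : i ∈ s) => hAB i).1 h.symm
    rw [← h, zero_mul, Finset.sum_eq_zero fun i hi => by rw [h0 i hi, zero_mul]]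
  · rw [← hP] at h
    have key := Real.strictConcave_binEntropy.concaveOn.le_map_sum (t := s)
      (w := fun i => (A i + B i) / P) (p := fun i => A i / (A i + B i))
      (fun i _ => div_nonneg (hAB i) h.le) (by rw [← Finset.sum_div, div_self h.ne'])
      (fun i _ => ⟨div_nonneg (hA i) (hAB i), div_le_one_of_le₀ (by linarith [hB i]) (hAB i)⟩)
    have hcancel (i : ι) : (A i + B i) / P * (A i / (A i + B i)) = A i / P := by
      rcases (hAB i).eq_or_lt with h' | h'
      · have : A i = 0 := by linarith [hA i, hB i]
        simp [this]
      · field_simp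
    simp only [smul_eq_mul, hcancel, ← Finset.sum_div] at key
    calc _ = P * ∑ i ∈ s, (A i + B i) / P * Real.binEntropy (A i / (A i + B i)) := by
          rw [Finset.mul_sum]
          exact Finset.sum_congr rfl fun i _ => by field_simp
      _ ≤ _ := mul_le_mul_of_nonneg_left key h.le

lemma sum_norm_sq_eq_one_of_orthonormal {ι κ : Type*} [Fintype ι] [Fintype κ] [DecidableEq ι]
    [DecidableEq κ] (e : ι ≃ κ) {u : ι → κ → ℂ}
    (hu : ∀ i j, ∑ x, (starRingEnd ℂ) (u i x) * u j x = if i = j then 1 else 0) (x : κ) :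
    ∑ i, ‖u i x‖ ^ 2 = 1 := by
  have h1 : (Matrix.of fun i x => (starRingEnd ℂ) (u i x)) * (Matrix.of fun x i => u i x) = 1 := by
    ext i j
    simp [Matrix.mul_apply, hu, Matrix.one_apply]
  have h2 := congr_fun₂ ((Matrix.mul_eq_one_comm_of_equiv e).1 h1) x x
  simp only [Matrix.mul_apply, Matrix.of_apply, Matrix.one_apply_eq, Complex.mul_conj'] at h2
  exact_mod_cast h2

/-- The determinant of a two-qubit pure state bounds its concurrence by the geometric means of its
even- and odd-parity weights. -/
lemma norm_mul_sub_mul_le {x y z w : ℂ} {α₀ α₁ β₀ β₁ : ℝ} (h0 : 0 ≤ α₀) (h1 : 0 ≤ α₁)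
    (h2 : 0 ≤ β₀) (h3 : 0 ≤ β₁) :
    √(α₀ * α₁ * β₀ * β₁ * ‖x * w - y * z‖ ^ 2) ≤
      √(‖x‖ ^ 2 * α₀ * β₀ * (‖w‖ ^ 2 * α₁ * β₁)) + √(‖y‖ ^ 2 * α₀ * β₁ * (‖z‖ ^ 2 * α₁ * β₀)) := by
  have hk : 0 ≤ α₀ * α₁ * β₀ * β₁ := by positivity
  rw [show ‖x‖ ^ 2 * α₀ * β₀ * (‖w‖ ^ 2 * α₁ * β₁) = α₀ * α₁ * β₀ * β₁ * ‖x * w‖ ^ 2 by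
      rw [norm_mul]; ring,
    show ‖y‖ ^ 2 * α₀ * β₁ * (‖z‖ ^ 2 * α₁ * β₀) = α₀ * α₁ * β₀ * β₁ * ‖y * z‖ ^ 2 by
      rw [norm_mul]; ring]
  simp only [Real.sqrt_mul hk, Real.sqrt_sq (norm_nonneg _)]
  rw [← mul_add]
  exact mul_le_mul_of_nonneg_left (norm_sub_le _ _) (Real.sqrt_nonneg _)

/-- Upper bound on the average post-measurement entropy in two-qubit
entanglement swapping (Theorem: upper bound on binary entanglement swapping). -/
theorem avg_entropy_le_bell_value
    (a b : Fin 2 → ℂ)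
    (ha : ‖a 0‖ ^ 2 + ‖a 1‖ ^ 2 = 1) (hb : ‖b 0‖ ^ 2 + ‖b 1‖ ^ 2 = 1)
    (u : Fin 4 → Fin 2 × Fin 2 → ℂ)
    (hu : ∀ i j : Fin 4,
      ∑ x : Fin 2 × Fin 2, (starRingEnd ℂ) (u i x) * u j x = if i = j then 1 else 0)
    (p : Fin 4 → ℝ)
    (hp : ∀ i, p i = ∑ x : Fin 2 × Fin 2, ‖u i x‖ ^ 2 * ‖a x.1‖ ^ 2 * ‖b x.2‖ ^ 2)
    (ρ : Fin 4 → Matrix (Fin 2) (Fin 2) ℂ)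
    (hρ : ∀ i, ∀ k k' : Fin 2, ρ i k k' = ((p i : ℝ) : ℂ)⁻¹ *
      (a k * (starRingEnd ℂ) (a k') *
        ∑ m : Fin 2, (starRingEnd ℂ) (u i (k, m)) * u i (k', m) * ((‖b m‖ ^ 2 : ℝ) : ℂ))) :
    ∑ i ∈ Finset.univ.filter (fun i => 0 < p i), p i * vnEntropy (ρ i) ≤
      (‖a 0 * b 0‖ ^ 2 + ‖a 1 * b 1‖ ^ 2) *
        binEnt (‖a 0 * b 0‖ ^ 2 / (‖a 0 * b 0‖ ^ 2 + ‖a 1 * b 1‖ ^ 2)) +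
      (‖a 0 * b 1‖ ^ 2 + ‖a 1 * b 0‖ ^ 2) *
        binEnt (‖a 0 * b 1‖ ^ 2 / (‖a 0 * b 1‖ ^ 2 + ‖a 1 * b 0‖ ^ 2)) := by
  set W : Fin 2 × Fin 2 → Fin 4 → ℝ := fun x i => ‖u i x‖ ^ 2 * ‖a x.1‖ ^ 2 * ‖b x.2‖ ^ 2
    with hW
  have hWnn (x : Fin 2 × Fin 2) (i : Fin 4) : 0 ≤ W x i := by positivity
  have hWsum (k m : Fin 2) : ∑ i, W (k, m) i = ‖a k * b m‖ ^ 2 := by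
    simp only [hW]
    rw [← Finset.sum_mul, ← Finset.sum_mul,
      sum_norm_sq_eq_one_of_orthonormal (finProdFinEquiv (m := 2) (n := 2)).symm hu, norm_mul]
    ring
  have hpW (i : Fin 4) :
      p i = W (0, 0) i + W (1, 1) i + (W (0, 1) i + W (1, 0) i) := by
    rw [hp, Fintype.sum_prod_type]
    simp only [Fin.sum_univ_two, hW]
    ring
  have hbin {A B : ℝ} (hA : 0 ≤ A) (hB : 0 ≤ B) :
      0 ≤ (A + B) * Real.binEntropy (A / (A + B)) :=
    mul_nonneg (add_nonneg hA hB) (Real.binEntropy_nonneg (by positivity)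
      (div_le_one_of_le₀ (by linarith) (by positivity)))
  have hterm (i : Fin 4) (hi : 0 < p i) : p i * vnEntropy (ρ i) ≤
      (W (0, 0) i + W (1, 1) i) * Real.binEntropy (W (0, 0) i / (W (0, 0) i + W (1, 1) i)) +
      (W (0, 1) i + W (1, 0) i) *
        Real.binEntropy (W (0, 1) i / (W (0, 1) i + W (1, 0) i)) := by
    set d : ℝ := ‖a 0‖ ^ 2 * ‖a 1‖ ^ 2 * ‖b 0‖ ^ 2 * ‖b 1‖ ^ 2 *
      ‖u i (0, 0) * u i (1, 1) - u i (0, 1) * u i (1, 0)‖ ^ 2 with hd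
    have hd0 : 0 ≤ d := by positivity
    have hpi : (p i : ℂ) ≠ 0 := by exact_mod_cast hi.ne'
    have hherm : (ρ i).IsHermitian := by
      ext k k'
      simp only [Matrix.conjTranspose_apply, hρ, Fin.sum_univ_two, RCLike.star_def, map_mul,
        map_add, map_inv₀, Complex.conj_ofReal, Complex.conj_conj]
      ring
    have htr : (ρ i).trace = 1 := by
      rw [Matrix.trace_fin_two, hρ, hρ, ← mul_add, inv_mul_eq_one₀ hpi, hpW]
      simp only [hW, Fin.sum_univ_two]
      push_cast
      simp only [← Complex.conj_mul']
      ring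
    have hdet : (ρ i).det = ((d / p i ^ 2 : ℝ) : ℂ) := by
      rw [Matrix.det_fin_two, hρ, hρ, hρ, hρ, hd]
      simp only [Fin.sum_univ_two]
      push_cast
      simp only [← Complex.conj_mul', map_sub, map_mul]
      field_simp
      ring
    rw [vnEntropy_fin_two hherm (by positivity) htr hdet, Real.sqrt_div hd0, Real.sqrt_sq hi.le,
      ← mul_div_assoc]
    rw [hpW] at hi ⊢
    refine mul_concurrenceEntropy_div_le (hWnn _ _) (hWnn _ _) (hWnn _ _) (hWnn _ _)
      (by positivity) ?_ hi
    rw [← mul_add]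
    exact mul_le_mul_of_nonneg_left (norm_mul_sub_mul_le (by positivity) (by positivity)
      (by positivity) (by positivity)) zero_le_two
  simp only [binEnt_eq_binEntropy, ← hWsum]
  refine le_trans ?_ (add_le_add
    (sum_mul_binEntropy_div_le Finset.univ (hWnn (0, 0)) (hWnn (1, 1)))
    (sum_mul_binEntropy_div_le Finset.univ (hWnn (0, 1)) (hWnn (1, 0))))
  rw [← Finset.sum_add_distrib]
  refine (Finset.sum_le_sum fun i hi => hterm i (Finset.mem_filter.1 hi).2).trans
    (Finset.sum_le_sum_of_subset_of_nonneg (Finset.filter_subset _ _) fun i _ _ => ?_)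
  exact add_nonneg (hbin (hWnn _ _) (hWnn _ _)) (hbin (hWnn _ _) (hWnn _ _))
end

section
/- In the two-qubit entanglement swapping setup, suppose the orthonormal basis u¹,…,u⁴ consists of the four Bell states (|00⟩±|11⟩)/√2 and (|01⟩±|10⟩)/√2. Then, with p0 := |a0·b0|² + |a1·b1|² and p1 := |a0·b1|² + |a1·b0|², equality holds: ∑_{i : p_i>0} p_i · S(ρⁱ) = p0 · h(|a0·b0|²/p0) + p1 · h(|a0·b1|²/p1), where a summand on the right-hand side is read as 0 when the corresponding p0 or p1 vanishes. -/
open Classical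

/-- The von Neumann entropy of a real diagonal matrix is the Shannon entropy of its diagonal. -/
theorem vnEntropy_diagonal_ofReal {n : Type*} [Fintype n] [DecidableEq n] (d : n → ℝ) :
    vnEntropy (Matrix.diagonal fun i => (d i : ℂ)) = ∑ i, Real.negMulLog (d i) := by
  have h : (Matrix.diagonal fun i => (d i : ℂ)).IsHermitian :=
    Matrix.isHermitian_diagonal_of_self_adjoint _ (by ext i; simp)
  have hroots := h.roots_charpoly_eq_eigenvalues
  have hprod : ∏ i, (Polynomial.X - Polynomial.C (d i : ℂ)) =
      ((Finset.univ.val.map fun i => (d i : ℂ)).map fun z =>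
        Polynomial.X - Polynomial.C z).prod := by
    rw [Multiset.map_map]; rfl
  rw [Matrix.charpoly_diagonal, hprod, Polynomial.roots_multiset_prod_X_sub_C] at hroots
  have hsum := congrArg (fun s : Multiset ℂ => (s.map fun z => Real.negMulLog z.re).sum) hroots
  simp only [Multiset.map_map] at hsum
  rw [vnEntropy, dif_pos h]
  exact hsum.symm

/-- The normalized state with weights `x` and `y` has binary entropy. -/
theorem mul_vnEntropy_eq_mul_binEnt {q x y : ℝ} (hq : q = (x + y) / 2)
    (M : Matrix (Fin 2) (Fin 2) ℂ)
    (hM : M = Matrix.diagonal fun i => ((![x / 2 / q, y / 2 / q] i : ℝ) : ℂ)) :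
    q * vnEntropy M = (x + y) / 2 * binEnt (x / (x + y)) := by
  subst hq
  rcases eq_or_ne (x + y) 0 with h | h
  · simp [h]
  · have hx : x / 2 / ((x + y) / 2) = x / (x + y) := by field_simp
    have hy : y / 2 / ((x + y) / 2) = 1 - x / (x + y) := by field_simp; ring
    rw [hM, vnEntropy_diagonal_ofReal, Fin.sum_univ_two, binEnt]
    simp only [Matrix.cons_val_zero, Matrix.cons_val_one, hx, hy]

/-- For measurement in the Bell basis, the average post-measurement entropy in
two-qubit entanglement swapping achieves the bound with equality. -/
theorem avg_entropy_eq_bell_value_for_bell_basis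
    (a b : Fin 2 → ℂ)
    (ha : ‖a 0‖ ^ 2 + ‖a 1‖ ^ 2 = 1) (hb : ‖b 0‖ ^ 2 + ‖b 1‖ ^ 2 = 1)
    (u : Fin 4 → Fin 2 × Fin 2 → ℂ)
    (hu0 : ∀ x : Fin 2 × Fin 2, u 0 x =
      if x = (0, 0) then (Real.sqrt 2 : ℂ)⁻¹ else if x = (1, 1) then (Real.sqrt 2 : ℂ)⁻¹ else 0)
    (hu1 : ∀ x : Fin 2 × Fin 2, u 1 x =
      if x = (0, 0) then (Real.sqrt 2 : ℂ)⁻¹ else if x = (1, 1) then -(Real.sqrt 2 : ℂ)⁻¹ else 0)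
    (hu2 : ∀ x : Fin 2 × Fin 2, u 2 x =
      if x = (0, 1) then (Real.sqrt 2 : ℂ)⁻¹ else if x = (1, 0) then (Real.sqrt 2 : ℂ)⁻¹ else 0)
    (hu3 : ∀ x : Fin 2 × Fin 2, u 3 x =
      if x = (0, 1) then (Real.sqrt 2 : ℂ)⁻¹ else if x = (1, 0) then -(Real.sqrt 2 : ℂ)⁻¹ else 0)
    (p : Fin 4 → ℝ)
    (hp : ∀ i, p i = ∑ x : Fin 2 × Fin 2, ‖u i x‖ ^ 2 * ‖a x.1‖ ^ 2 * ‖b x.2‖ ^ 2)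
    (ρ : Fin 4 → Matrix (Fin 2) (Fin 2) ℂ)
    (hρ : ∀ i, ∀ k k' : Fin 2, ρ i k k' = ((p i : ℝ) : ℂ)⁻¹ *
      (a k * (starRingEnd ℂ) (a k') *
        ∑ m : Fin 2, (starRingEnd ℂ) (u i (k, m)) * u i (k', m) * ((‖b m‖ ^ 2 : ℝ) : ℂ))) :
    ∑ i ∈ Finset.univ.filter (fun i => 0 < p i), p i * vnEntropy (ρ i) =
      (‖a 0 * b 0‖ ^ 2 + ‖a 1 * b 1‖ ^ 2) *
        binEnt (‖a 0 * b 0‖ ^ 2 / (‖a 0 * b 0‖ ^ 2 + ‖a 1 * b 1‖ ^ 2)) +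
      (‖a 0 * b 1‖ ^ 2 + ‖a 1 * b 0‖ ^ 2) *
        binEnt (‖a 0 * b 1‖ ^ 2 / (‖a 0 * b 1‖ ^ 2 + ‖a 1 * b 0‖ ^ 2)) := by
  have hs : ((Real.sqrt 2 : ℝ) : ℂ)⁻¹ * ((Real.sqrt 2 : ℝ) : ℂ)⁻¹ = 2⁻¹ := by
    rw [← mul_inv, ← Complex.ofReal_mul, Real.mul_self_sqrt (by norm_num)]
    norm_num
  have hz (z : ℂ) : z * (starRingEnd ℂ) z = (‖z‖ : ℂ) ^ 2 := Complex.mul_conj' z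
  have hsum : ∑ i ∈ Finset.univ.filter (fun i => 0 < p i), p i * vnEntropy (ρ i) =
      ∑ i, p i * vnEntropy (ρ i) := by
    refine Finset.sum_filter_of_ne fun i _ hi => ?_
    have hnonneg : 0 ≤ p i := by rw [hp]; positivity
    exact hnonneg.lt_of_ne fun h => hi (by simp [← h])
  have hp0 : p 0 = (‖a 0 * b 0‖ ^ 2 + ‖a 1 * b 1‖ ^ 2) / 2 := by
    simp [hp, hu0, Fintype.sum_prod_type, mul_pow]; ring
  have hp1 : p 1 = (‖a 0 * b 0‖ ^ 2 + ‖a 1 * b 1‖ ^ 2) / 2 := by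
    simp [hp, hu1, Fintype.sum_prod_type, mul_pow]; ring
  have hp2 : p 2 = (‖a 0 * b 1‖ ^ 2 + ‖a 1 * b 0‖ ^ 2) / 2 := by
    simp [hp, hu2, Fintype.sum_prod_type, mul_pow]; ring
  have hp3 : p 3 = (‖a 0 * b 1‖ ^ 2 + ‖a 1 * b 0‖ ^ 2) / 2 := by
    simp [hp, hu3, Fintype.sum_prod_type, mul_pow]; ring
  have h0 := mul_vnEntropy_eq_mul_binEnt hp0 (ρ 0) (by
    ext k l
    fin_cases k <;> fin_cases l <;> simp [hρ, hu0, hz, hs, mul_pow] <;> ring)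
  have h1 := mul_vnEntropy_eq_mul_binEnt hp1 (ρ 1) (by
    ext k l
    fin_cases k <;> fin_cases l <;> simp [hρ, hu1, hz, hs, mul_pow] <;> ring)
  have h2 := mul_vnEntropy_eq_mul_binEnt hp2 (ρ 2) (by
    ext k l
    fin_cases k <;> fin_cases l <;> simp [hρ, hu2, hz, hs, mul_pow] <;> ring)
  have h3 := mul_vnEntropy_eq_mul_binEnt hp3 (ρ 3) (by
    ext k l
    fin_cases k <;> fin_cases l <;> simp [hρ, hu3, hz, hs, mul_pow] <;> ring)
  rw [hsum, Fin.sum_univ_four, h0, h1, h2, h3]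
  ring
end

section
/- Let d0 ≥ 2, let (a_k)_{k<d0}, (b_k)_{k<d0} ∈ ℂ^{d0}, and let (u_x)_{x∈{0,…,d0−1}²} be the coordinates of any unit vector u in ℂ^{d0}⊗ℂ^{d0}. Define the d0×d0 matrix ρ̃ with entries ρ̃_{k,k'} = a_k·conj(a_{k'})·∑_{m<d0} conj(u_{k,m})·u_{k',m}·|b_m|². Then the squared concurrence of ρ̃ satisfies 2·((tr ρ̃)² − tr(ρ̃²)) = 4 · ∑_{x₁<x'₁, x₂<x'₂} |u_{x₁,x₂}·u_{x'₁,x'₂} − u_{x₁,x'₂}·u_{x'₁,x₂}|² · |a_{x₁}|²·|a_{x'₁}|²·|b_{x₂}|²·|b_{x'₂}|², where the sum runs over 0 ≤ x₁ < x'₁ < d0 and 0 ≤ x₂ < x'₂ < d0. -/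
open Classical

/-- The sum over all pairs of a symmetric function vanishing on the diagonal is twice
the sum over the strictly increasing pairs. -/
theorem sum_sum_eq_two_mul_sum_sum_lt {ι : Type*} [Fintype ι] [LinearOrder ι] {R : Type*}
    [CommSemiring R] (f : ι → ι → R) (hsymm : ∀ i j, f i j = f j i) (hdiag : ∀ i, f i i = 0) :
    ∑ i, ∑ j, f i j = 2 * ∑ i, ∑ j, if i < j then f i j else 0 := by
  have hsplit : ∀ i j, f i j = (if i < j then f i j else 0) + (if j < i then f j i else 0) := by
    intro i j
    rcases lt_trichotomy i j with h | rfl | h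
    · simp [h, h.not_gt]
    · simp [hdiag]
    · simp [h, h.not_gt, hsymm i j]
  rw [Finset.sum_congr rfl fun i _ => Finset.sum_congr rfl fun j _ => hsplit i j]
  simp only [Finset.sum_add_distrib]
  rw [Finset.sum_comm (f := fun i j => if j < i then f j i else 0), two_mul]

/-- The difference of the squared trace and the trace of the square of a matrix, with the
sum defining the entries expanded, is a sum of squared moduli of two-by-two minors. -/
theorem two_mul_trace_sq_sub_trace_mul_self {ι κ : Type*} [Fintype ι] [Fintype κ]
    (a : ι → ℂ) (b : κ → ℂ) (u : ι × κ → ℂ) (ρ : Matrix ι ι ℂ)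
    (hρ : ∀ k k' : ι, ρ k k' = a k * (starRingEnd ℂ) (a k') *
      ∑ m : κ, (starRingEnd ℂ) (u (k, m)) * u (k', m) * ((‖b m‖ ^ 2 : ℝ) : ℂ)) :
    2 * ((Matrix.trace ρ) ^ 2 - Matrix.trace (ρ * ρ)) =
      ((∑ x₁ : ι, ∑ x₁' : ι, ∑ x₂ : κ, ∑ x₂' : κ,
        ‖u (x₁, x₂) * u (x₁', x₂') - u (x₁, x₂') * u (x₁', x₂)‖ ^ 2 *
          ‖a x₁‖ ^ 2 * ‖a x₁'‖ ^ 2 * ‖b x₂‖ ^ 2 * ‖b x₂'‖ ^ 2 : ℝ) : ℂ) := by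
  set F : ι → ι → κ → κ → ℂ := fun k k' m n =>
    (a k * (starRingEnd ℂ) (a k)) * (a k' * (starRingEnd ℂ) (a k')) *
      ((‖b m‖ ^ 2 : ℝ) : ℂ) * ((‖b n‖ ^ 2 : ℝ) : ℂ) *
      ((starRingEnd ℂ) (u (k, m)) * u (k, m) * (starRingEnd ℂ) (u (k', n)) * u (k', n) -
        (starRingEnd ℂ) (u (k, m)) * u (k', m) * (starRingEnd ℂ) (u (k', n)) * u (k, n)) with hF
  have hdiff : (Matrix.trace ρ) ^ 2 - Matrix.trace (ρ * ρ) =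
      ∑ k, ∑ k', ∑ m, ∑ n, F k k' m n := by
    simp only [Matrix.trace, Matrix.diag, Matrix.mul_apply, sq, Finset.sum_mul_sum]
    simp only [← Finset.sum_sub_distrib]
    refine Finset.sum_congr rfl fun k _ => Finset.sum_congr rfl fun k' _ => ?_
    have hmul : ∀ (c d : ℂ) (p q : κ → ℂ),
        c * (∑ m, p m) * (d * ∑ n, q n) = ∑ m, ∑ n, c * d * (p m * q n) := by
      intro c d p q
      simp only [← Finset.mul_sum, ← Finset.sum_mul]
      ring
    rw [hρ, hρ, hρ, hρ, hmul, hmul]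
    simp only [← Finset.sum_sub_distrib]
    refine Finset.sum_congr rfl fun m _ => Finset.sum_congr rfl fun n _ => ?_
    simp only [hF]
    ring
  have hswap : ∑ k, ∑ k', ∑ m, ∑ n, F k k' m n = ∑ k, ∑ k', ∑ m, ∑ n, F k k' n m :=
    Finset.sum_congr rfl fun k _ => Finset.sum_congr rfl fun k' _ => Finset.sum_comm
  rw [hdiff, two_mul]
  nth_rewrite 2 [hswap]
  simp only [← Finset.sum_add_distrib]
  push_cast
  refine Finset.sum_congr rfl fun k _ => Finset.sum_congr rfl fun k' _ =>
    Finset.sum_congr rfl fun m _ => Finset.sum_congr rfl fun n _ => ?_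
  simp only [hF, ← Complex.mul_conj', map_sub, map_mul, Complex.ofReal_pow]
  ring

/-- Squared-concurrence formula for the unnormalized post-measurement reduced
state on subsystem A in the qudit entanglement swapping setup. -/
theorem squared_concurrence_formula
    (d0 : ℕ) (hd0 : 2 ≤ d0)
    (a b : Fin d0 → ℂ)
    (u : Fin d0 × Fin d0 → ℂ) (hu : ∑ x : Fin d0 × Fin d0, ‖u x‖ ^ 2 = 1)
    (ρ : Matrix (Fin d0) (Fin d0) ℂ)
    (hρ : ∀ k k' : Fin d0, ρ k k' = a k * (starRingEnd ℂ) (a k') *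
      ∑ m : Fin d0, (starRingEnd ℂ) (u (k, m)) * u (k', m) * ((‖b m‖ ^ 2 : ℝ) : ℂ)) :
    2 * ((Matrix.trace ρ) ^ 2 - Matrix.trace (ρ * ρ)) =
      ((4 * ∑ x₁ : Fin d0, ∑ x₁' : Fin d0, ∑ x₂ : Fin d0, ∑ x₂' : Fin d0,
        if x₁ < x₁' ∧ x₂ < x₂' then
          ‖u (x₁, x₂) * u (x₁', x₂') - u (x₁, x₂') * u (x₁', x₂)‖ ^ 2 *
            ‖a x₁‖ ^ 2 * ‖a x₁'‖ ^ 2 * ‖b x₂‖ ^ 2 * ‖b x₂'‖ ^ 2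
        else 0 : ℝ) : ℂ) := by
  rw [two_mul_trace_sq_sub_trace_mul_self a b u ρ hρ]
  congr 1
  rw [sum_sum_eq_two_mul_sum_sum_lt, show (4 : ℝ) = 2 * 2 by norm_num, mul_assoc]
  · congr 1
    rw [Finset.mul_sum]
    refine Finset.sum_congr rfl fun k _ => ?_
    rw [Finset.mul_sum]
    refine Finset.sum_congr rfl fun k' _ => ?_
    by_cases h : k < k'
    · simp only [h, true_and, if_true]
      refine sum_sum_eq_two_mul_sum_sum_lt _ (fun m n => ?_) fun m => by simp
      rw [norm_sub_rev]
      ring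
    · simp [h]
  · intro k k'
    refine Finset.sum_congr rfl fun m _ => Finset.sum_congr rfl fun n _ => ?_
    rw [norm_sub_rev, mul_comm (u (k, n)), mul_comm (u (k, m))]
    ring
  · intro k
    refine Finset.sum_eq_zero fun m _ => Finset.sum_eq_zero fun n _ => ?_
    simp [mul_comm (u (k, m))]
end

section
/- In the qudit entanglement swapping setup, let ε > 0 and suppose |⟨φ_{i,k}|φ_{i,k'}⟩|² ≥ ε for every outcome i and all k,k' with q_{i,k} > 0 and q_{i,k'} > 0. Then the average largest eigenvalue of the post-measurement reduced state on A satisfies ∑_{i : p_i>0} p_i · ‖ρ_A^i‖_∞ ≥ (1−ε) · ‖ρ_A‖_∞ + ε, where ρ_A = diag(λ₀,…,λ_{d0−1}) is the pre-measurement reduced state on A and ‖·‖_∞ denotes the largest eigenvalue of a positive semidefinite Hermitian matrix. -/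
open Classical Matrix

/-- Largest eigenvalue of a (Hermitian) matrix; junk value 0 otherwise. -/
noncomputable def maxEig {n : Type*} [Fintype n] [DecidableEq n] (ρ : Matrix n n ℂ) : ℝ :=
  if h : ρ.IsHermitian then ⨆ i, h.eigenvalues i else 0

theorem maxEig_mem_spectrum {n : Type*} [Fintype n] [DecidableEq n] [Nonempty n]
    {ρ : Matrix n n ℂ} (h : ρ.IsHermitian) : maxEig ρ ∈ spectrum ℝ ρ := by
  obtain ⟨j, hj⟩ := exists_eq_ciSup_of_finite (f := h.eigenvalues)
  rw [maxEig, dif_pos h, ← hj]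
  exact h.eigenvalues_mem_spectrum_real j

theorem maxEig_diagonal_mem_range {n : Type*} [Fintype n] [DecidableEq n] [Nonempty n]
    (v : n → ℝ) : ∃ m, maxEig (Matrix.diagonal fun k => ((v k : ℝ) : ℂ)) = v m := by
  have h : (Matrix.diagonal fun k => ((v k : ℝ) : ℂ)).IsHermitian := by
    rw [Matrix.isHermitian_diagonal_iff]
    intro k
    exact Complex.conj_ofReal (v k)
  have hs := maxEig_mem_spectrum h
  rw [← spectrum.algebraMap_mem_iff ℂ, spectrum_diagonal] at hs
  obtain ⟨m, hm⟩ := hs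
  exact ⟨m, (Complex.ofReal_injective hm).symm⟩

open scoped ComplexOrder in
/-- `(ρ²)ₘₘ ≤ ‖ρ‖_∞ ρₘₘ` for positive semidefinite `ρ`. -/
theorem sum_norm_sq_row_le_maxEig_mul {n : Type*} [Fintype n] [DecidableEq n]
    {ρ : Matrix n n ℂ} (hρ : ρ.PosSemidef) (m : n) :
    ∑ k, ‖ρ m k‖ ^ 2 ≤ maxEig ρ * (ρ m m).re := by
  have h := hρ.isHermitian
  set V : Matrix n n ℂ := (h.eigenvectorUnitary : Matrix n n ℂ)
  have hVV : Vᴴ * V = 1 := Unitary.coe_star_mul_self h.eigenvectorUnitary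
  set D : Matrix n n ℂ := Matrix.diagonal fun j => (h.eigenvalues j : ℂ) with hD
  have hspec : ρ = V * D * Vᴴ := by
    have := h.spectral_theorem
    rw [Unitary.conjStarAlgAut_apply] at this
    exact this
  have hentry (w : n → ℝ) :
      (V * Matrix.diagonal (fun j => (w j : ℂ)) * Vᴴ) m m =
        ((∑ j, w j * ‖V m j‖ ^ 2 : ℝ) : ℂ) := by
    rw [Matrix.mul_apply]
    push_cast
    refine Finset.sum_congr rfl fun j _ => ?_
    rw [Matrix.mul_diagonal, Matrix.conjTranspose_apply, ← Complex.mul_conj']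
    simp only [RCLike.star_def]
    ring
  have hsq : ρ * ρ = V * Matrix.diagonal (fun j => ((h.eigenvalues j ^ 2 : ℝ) : ℂ)) * Vᴴ := by
    calc ρ * ρ = V * D * (Vᴴ * V) * D * Vᴴ := by
          conv_lhs => rw [hspec]
          simp only [Matrix.mul_assoc]
      _ = _ := by
          rw [hVV, Matrix.mul_one, Matrix.mul_assoc V D D, hD, Matrix.diagonal_mul_diagonal]
          simp [pow_two]
  have hrow : ((∑ k, ‖ρ m k‖ ^ 2 : ℝ) : ℂ) = (ρ * ρ) m m := by
    rw [Matrix.mul_apply]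
    push_cast
    refine Finset.sum_congr rfl fun k _ => ?_
    rw [← Complex.mul_conj', ← h.apply k m]
    rfl
  have hrow' : ∑ k, ‖ρ m k‖ ^ 2 = ∑ j, h.eigenvalues j ^ 2 * ‖V m j‖ ^ 2 := by
    rw [hsq, hentry] at hrow
    exact_mod_cast hrow
  have hdiag : (ρ m m).re = ∑ j, h.eigenvalues j * ‖V m j‖ ^ 2 := by
    have := hentry h.eigenvalues
    rw [← hD, ← hspec] at this
    rw [this, Complex.ofReal_re]
  rw [hrow', hdiag, Finset.mul_sum]
  refine Finset.sum_le_sum fun j _ => ?_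
  have hle : h.eigenvalues j ≤ maxEig ρ := by
    rw [maxEig, dif_pos h]
    exact le_ciSup (Set.finite_range _).bddAbove j
  have hnn := hρ.eigenvalues_nonneg j
  rw [pow_two, mul_assoc]
  exact mul_le_mul_of_nonneg_right hle (by positivity)

open scoped ComplexOrder in
theorem le_maxEig_of_overlap {n : Type*} [Fintype n] [DecidableEq n]
    {ρ : Matrix n n ℂ} (hρ : ρ.PosSemidef) {r : n → ℝ} (hr : ∀ k, ρ k k = (r k : ℂ))
    (hr1 : ∑ k, r k = 1) {ε : ℝ}
    (hover : ∀ m k, ε * (r m * r k) ≤ ‖ρ m k‖ ^ 2) (m : n) :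
    (1 - ε) * r m + ε ≤ maxEig ρ := by
  have hr0 (k : n) : 0 ≤ r k := by
    have := hρ.diag_nonneg (i := k)
    rw [hr k] at this
    exact_mod_cast this
  have hpos {k : n} (hk : 0 < r k) : (1 - ε) * r k + ε ≤ maxEig ρ := by
    have hle := sum_norm_sq_row_le_maxEig_mul hρ k
    rw [hr k, Complex.ofReal_re] at hle
    refine le_of_mul_le_mul_right (le_trans ?_ hle) hk
    rw [← Finset.add_sum_erase _ _ (Finset.mem_univ k)]
    have hs : r k + ∑ j ∈ Finset.univ.erase k, r j = 1 := by
      rw [Finset.add_sum_erase _ _ (Finset.mem_univ k), hr1]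
    have hoff : ε * r k * ∑ j ∈ Finset.univ.erase k, r j ≤
        ∑ j ∈ Finset.univ.erase k, ‖ρ k j‖ ^ 2 := by
      rw [Finset.mul_sum]
      refine Finset.sum_le_sum fun j _ => ?_
      linarith [hover k j]
    have hd : ‖ρ k k‖ ^ 2 = r k ^ 2 := by
      rw [hr k, Complex.norm_real, Real.norm_eq_abs, sq_abs]
    rw [eq_sub_of_add_eq' hs] at hoff
    rw [hd]
    linarith
  rcases (hr0 m).lt_or_eq with hm | hm
  · exact hpos hm
  · obtain ⟨k, -, hk⟩ : ∃ k ∈ Finset.univ, 0 < r k :=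
      Finset.exists_lt_of_sum_lt (f := fun _ => (0 : ℝ)) (by simp [hr1])
    have hε1 : ε ≤ 1 := by
      have := hover k k
      rw [hr k, Complex.norm_real, Real.norm_eq_abs, sq_abs] at this
      nlinarith [mul_pos hk hk]
    rw [← hm]
    nlinarith [hpos hk, mul_nonneg (sub_nonneg.2 hε1) hk.le]

theorem sum_norm_sq_mulVec_of_isometry {n : Type*} [Fintype n] [DecidableEq n]
    {U : Matrix n n ℂ} (hU : Uᴴ * U = 1) (v : n → ℂ) :
    ∑ x, ‖(U *ᵥ v) x‖ ^ 2 = ∑ x, ‖v x‖ ^ 2 := by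
  have key (w : n → ℂ) : ((∑ x, ‖w x‖ ^ 2 : ℝ) : ℂ) = star w ⬝ᵥ w := by
    push_cast
    refine Finset.sum_congr rfl fun x _ => ?_
    rw [← Complex.conj_mul']
    rfl
  have h : star (U *ᵥ v) ⬝ᵥ (U *ᵥ v) = star v ⬝ᵥ v := by
    rw [Matrix.star_mulVec, Matrix.dotProduct_mulVec, Matrix.vecMul_vecMul, hU, Matrix.vecMul_one]
  rw [← key, ← key] at h
  exact_mod_cast h

/-- The outcome probabilities conditioned on `k` in register `B` sum to one. -/
theorem sum_outcome_prob_eq_one {β γ δ : Type*} [Fintype β] [DecidableEq β] [Fintype γ]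
    [DecidableEq γ] [Fintype δ] {U : Matrix (β × γ) (β × γ) ℂ} (hU : Uᴴ * U = 1)
    {b : γ × δ → ℂ} (hb : ∑ x, ‖b x‖ ^ 2 = 1) (k : β) :
    ∑ i, ∑ cd : γ × δ, ‖∑ y, U (i, cd.1) (k, y) * b (y, cd.2)‖ ^ 2 = 1 := by
  have hcol (d : δ) :
      ∑ x : β × γ, ‖∑ y, U x (k, y) * b (y, d)‖ ^ 2 = ∑ y, ‖b (y, d)‖ ^ 2 := by
    have h := sum_norm_sq_mulVec_of_isometry hU
      (fun x : β × γ => if x.1 = k then b (x.2, d) else 0)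
    have hl (x : β × γ) : (U *ᵥ fun x : β × γ => if x.1 = k then b (x.2, d) else 0) x =
        ∑ y, U x (k, y) * b (y, d) := by
      simp only [Matrix.mulVec, dotProduct, Fintype.sum_prod_type, mul_ite, mul_zero]
      rw [Finset.sum_eq_single k (fun j _ hj => by simp [hj]) (by simp)]
      simp
    have hright : ∑ x : β × γ, ‖if x.1 = k then b (x.2, d) else 0‖ ^ 2 =
        ∑ y, ‖b (y, d)‖ ^ 2 := by
      rw [Fintype.sum_prod_type, Finset.sum_eq_single k (fun j _ hj => by simp [hj]) (by simp)]
      simp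
    simp only [hl] at h
    rw [h, hright]
  calc _ = ∑ d, ∑ x : β × γ, ‖∑ y, U x (k, y) * b (y, d)‖ ^ 2 := by
        simp only [Fintype.sum_prod_type_right (α₁ := γ) (α₂ := δ)]
        rw [Finset.sum_comm]
        refine Finset.sum_congr rfl fun d _ => ?_
        rw [Fintype.sum_prod_type]
    _ = 1 := by
        simp only [hcol]
        rw [← hb, Fintype.sum_prod_type_right]

open scoped ComplexOrder in
theorem posSemidef_of_scaled_gram {n κ : Type*} [Fintype n] [Fintype κ] {c : ℝ} (hc : 0 ≤ c)
    (s : n → ℝ) (v : n → κ → ℂ) {ρ : Matrix n n ℂ}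
    (hρ : ∀ k k', ρ k k' = ((c * s k * s k' : ℝ) : ℂ) * ∑ x, v k x * (starRingEnd ℂ) (v k' x)) :
    ρ.PosSemidef := by
  set W : Matrix n κ ℂ := Matrix.of fun k x => (s k : ℂ) * v k x with hW
  have hρW : ρ = c • (W * Wᴴ) := by
    ext k k'
    rw [hρ, Matrix.smul_apply, Matrix.mul_apply, Complex.real_smul, Finset.mul_sum, Finset.mul_sum]
    refine Finset.sum_congr rfl fun x _ => ?_
    simp only [hW, Matrix.conjTranspose_apply, Matrix.of_apply, RCLike.star_def, map_mul,
      Complex.conj_ofReal]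
    push_cast
    ring
  rw [hρW]
  exact (Matrix.posSemidef_self_mul_conjTranspose W).smul hc

/-- Imperfect entanglement swapping increases the top Schmidt coefficient:
in the qudit entanglement swapping setup, if all post-measurement overlaps
satisfy |⟨φ_{i,k}|φ_{i,k'}⟩|² ≥ ε, then the expected largest eigenvalue of the
post-measurement reduced state on A is at least (1−ε)·‖ρ_A‖_∞ + ε. -/
theorem imperfect_swapping_topSchmidt
    (d0 : ℕ) (hd0 : 2 ≤ d0) (ε : ℝ) (hε : 0 < ε)
    (lam : Fin d0 → ℝ) (hlam0 : ∀ k, 0 ≤ lam k) (hlam1 : ∑ k, lam k = 1)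
    (b : Fin d0 × Fin d0 → ℂ) (hb : ∑ x : Fin d0 × Fin d0, ‖b x‖ ^ 2 = 1)
    (U : Matrix (Fin d0 × Fin d0) (Fin d0 × Fin d0) ℂ) (hU : Uᴴ * U = 1)
    -- unnormalized post-measurement vectors φ̃_{i,k} on registers (C, D)
    (φt : Fin d0 → Fin d0 → Fin d0 × Fin d0 → ℂ)
    (hφt : ∀ i k : Fin d0, ∀ cd : Fin d0 × Fin d0,
      φt i k cd = ∑ yC : Fin d0, U (i, cd.1) (k, yC) * b (yC, cd.2))
    (q : Fin d0 → Fin d0 → ℝ)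
    (hq : ∀ i k, q i k = ∑ cd : Fin d0 × Fin d0, ‖φt i k cd‖ ^ 2)
    (p : Fin d0 → ℝ) (hp : ∀ i, p i = ∑ k, lam k * q i k)
    -- the normalized post-measurement reduced density matrix on A
    (ρA : Fin d0 → Matrix (Fin d0) (Fin d0) ℂ)
    (hρA : ∀ i, ∀ k k' : Fin d0, ρA i k k' =
      (((p i)⁻¹ * Real.sqrt (lam k) * Real.sqrt (lam k') : ℝ) : ℂ) *
        ∑ cd : Fin d0 × Fin d0, φt i k cd * (starRingEnd ℂ) (φt i k' cd))
    -- ε-imperfectness: all normalized overlaps are at least ε in squared modulus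
    (hover : ∀ i k k' : Fin d0, 0 < q i k → 0 < q i k' →
      ε ≤ ‖∑ cd : Fin d0 × Fin d0, (starRingEnd ℂ) (φt i k cd) * φt i k' cd‖ ^ 2 /
            (q i k * q i k')) :
    (1 - ε) * maxEig (Matrix.diagonal fun k => ((lam k : ℝ) : ℂ)) + ε ≤
      ∑ i ∈ Finset.univ.filter (fun i : Fin d0 => 0 < p i), p i * maxEig (ρA i) := by
  have : Nonempty (Fin d0) := ⟨⟨0, by omega⟩⟩
  obtain ⟨m, hm⟩ := maxEig_diagonal_mem_range lam
  rw [hm]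
  have hq0 (i k) : 0 ≤ q i k := by
    rw [hq]
    positivity
  have hqsum (k) : ∑ i, q i k = 1 := by
    simp only [hq, hφt]
    exact sum_outcome_prob_eq_one hU hb k
  have hpsum : ∑ i, p i = 1 := by
    simp only [hp]
    rw [Finset.sum_comm]
    simp only [← Finset.mul_sum, hqsum, mul_one, hlam1]
  have ha0 (i k) : 0 ≤ lam k * q i k := mul_nonneg (hlam0 k) (hq0 i k)
  have hp0 (i) : 0 ≤ p i := by
    rw [hp]
    exact Finset.sum_nonneg fun k _ => ha0 i k
  have houtcome (i) (hi : 0 < p i) :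
      (1 - ε) * (lam m * q i m) + ε * p i ≤ p i * maxEig (ρA i) := by
    have hpsd := posSemidef_of_scaled_gram (inv_nonneg.2 hi.le)
      (fun k => Real.sqrt (lam k)) (φt i) (hρA i)
    have hdiag (k) : ρA i k k = (((p i)⁻¹ * (lam k * q i k) : ℝ) : ℂ) := by
      rw [hρA, mul_assoc (p i)⁻¹, Real.mul_self_sqrt (hlam0 k), hq]
      simp only [Complex.mul_conj']
      push_cast
      ring
    have htr : ∑ k, (p i)⁻¹ * (lam k * q i k) = 1 := by
      rw [← Finset.mul_sum, ← hp, inv_mul_cancel₀ hi.ne']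
    have hov (k k') : ε * ((p i)⁻¹ * (lam k * q i k) * ((p i)⁻¹ * (lam k' * q i k'))) ≤
        ‖ρA i k k'‖ ^ 2 := by
      rcases (hq0 i k).eq_or_lt with hk | hk
      · simp only [← hk, mul_zero, zero_mul]
        positivity
      rcases (hq0 i k').eq_or_lt with hk' | hk'
      · simp only [← hk', mul_zero]
        positivity
      have h := (le_div_iff₀ (mul_pos hk' hk)).1 (hover i k' k hk' hk)
      rw [hρA, norm_mul, mul_pow, Complex.norm_real, Real.norm_eq_abs, sq_abs, mul_pow, mul_pow,
        Real.sq_sqrt (hlam0 k), Real.sq_sqrt (hlam0 k')]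
      simp only [mul_comm (φt i k _)]
      have hc : 0 ≤ (p i)⁻¹ ^ 2 * lam k * lam k' :=
        mul_nonneg (mul_nonneg (sq_nonneg _) (hlam0 k)) (hlam0 k')
      linarith [mul_le_mul_of_nonneg_left h hc]
    have h := mul_le_mul_of_nonneg_left (le_maxEig_of_overlap hpsd hdiag htr hov m) hi.le
    refine le_trans (le_of_eq ?_) h
    field_simp
  have hzero (i) (hi : ¬ 0 < p i) : (1 - ε) * (lam m * q i m) + ε * p i = 0 := by
    have hpi : p i = 0 := le_antisymm (not_lt.1 hi) (hp0 i)
    have hle : lam m * q i m ≤ p i := by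
      rw [hp]
      exact Finset.single_le_sum (fun k _ => ha0 i k) (Finset.mem_univ m)
    rw [le_antisymm (hle.trans hpi.le) (ha0 i m), hpi]
    ring
  calc (1 - ε) * lam m + ε = ∑ i, ((1 - ε) * (lam m * q i m) + ε * p i) := by
        rw [Finset.sum_add_distrib, ← Finset.mul_sum, ← Finset.mul_sum, ← Finset.mul_sum, hqsum,
          hpsum]
        ring
    _ = ∑ i ∈ Finset.univ.filter (fun i : Fin d0 => 0 < p i),
          ((1 - ε) * (lam m * q i m) + ε * p i) :=
        (Finset.sum_filter_of_ne fun i _ h => not_not.1 fun hi => h (hzero i hi)).symm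
    _ ≤ _ := Finset.sum_le_sum fun i hi => houtcome i (Finset.mem_filter.1 hi).2
end

section
/- In the qudit entanglement swapping setup, after applying U to registers (B,C) measure both registers B and C in the computational basis; for outcomes (i,j) let p_{i,j} be the outcome probability and ρ_A^{(i,j)} the normalized post-measurement reduced density matrix on A (so that ∑_j p_{i,j} = p_i and ∑_j (p_{i,j}/p_i)·ρ_A^{(i,j)} = ρ_A^i for p_i > 0). Let ε > 0 and suppose |⟨φ_{i,k}|φ_{i,k'}⟩|² ≥ ε for every i and all k,k' with q_{i,k} > 0 and q_{i,k'} > 0. Then ∑_{(i,j) : p_{i,j}>0} p_{i,j} · ‖ρ_A^{(i,j)}‖_∞ ≥ ∑_{i : p_i>0} p_i · ‖∑_j (p_{i,j}/p_i)·ρ_A^{(i,j)}‖_∞ ≥ (1−ε)·‖ρ_A‖_∞ + ε, where ρ_A = diag(λ₀,…,λ_{d0−1}) and ‖·‖_∞ denotes the largest eigenvalue of a positive semidefinite Hermitian matrix. -/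
open Classical Matrix

namespace Matrix

open scoped ComplexOrder

variable {n : Type*} [Fintype n] [DecidableEq n] {H : Matrix n n ℂ}

theorem IsHermitian.eigenvalues_le_maxEig (hH : H.IsHermitian) (i : n) :
    hH.eigenvalues i ≤ maxEig H := by
  rw [maxEig, dif_pos hH]
  exact le_ciSup (Set.finite_range _).bddAbove i

theorem IsHermitian.eq_mul_diagonal_mul_conjTranspose (hH : H.IsHermitian) :
    H = (hH.eigenvectorUnitary : Matrix n n ℂ) *
      diagonal (fun i => ((hH.eigenvalues i : ℝ) : ℂ)) *
        (hH.eigenvectorUnitary : Matrix n n ℂ)ᴴ := by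
  conv_lhs => rw [hH.spectral_theorem, Unitary.conjStarAlgAut_apply]
  rfl

theorem IsHermitian.conjTranspose_mul_eigenvectorUnitary (hH : H.IsHermitian) :
    (hH.eigenvectorUnitary : Matrix n n ℂ)ᴴ * hH.eigenvectorUnitary = 1 :=
  Unitary.coe_star_mul_self hH.eigenvectorUnitary

theorem IsHermitian.eigenvectorUnitary_mul_conjTranspose (hH : H.IsHermitian) :
    (hH.eigenvectorUnitary : Matrix n n ℂ) * (hH.eigenvectorUnitary : Matrix n n ℂ)ᴴ = 1 :=
  Unitary.coe_mul_star_self hH.eigenvectorUnitary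

theorem IsHermitian.smul_one_sub_eq (hH : H.IsHermitian) (c : ℝ) :
    c • (1 : Matrix n n ℂ) - H = (hH.eigenvectorUnitary : Matrix n n ℂ) *
      diagonal (fun i => ((c - hH.eigenvalues i : ℝ) : ℂ)) *
        (hH.eigenvectorUnitary : Matrix n n ℂ)ᴴ := by
  have hdiag : diagonal (fun i => ((c - hH.eigenvalues i : ℝ) : ℂ)) =
      c • (1 : Matrix n n ℂ) - diagonal (fun i => ((hH.eigenvalues i : ℝ) : ℂ)) := by
    ext i j
    by_cases hij : i = j
    · subst hij; simp
    · simp [hij]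
  rw [hdiag, mul_sub, sub_mul, ← hH.eq_mul_diagonal_mul_conjTranspose, Matrix.mul_smul, mul_one,
    Matrix.smul_mul, hH.eigenvectorUnitary_mul_conjTranspose]

/-- A real number `c` bounds the eigenvalues of `H` exactly when `c • 1 - H` is positive
semidefinite. -/
theorem IsHermitian.maxEig_le_iff [Nonempty n] (hH : H.IsHermitian) (c : ℝ) :
    maxEig H ≤ c ↔ (c • (1 : Matrix n n ℂ) - H).PosSemidef := by
  constructor
  · intro h
    rw [hH.smul_one_sub_eq]
    refine (PosSemidef.diagonal fun i => ?_).mul_mul_conjTranspose_same _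
    exact Complex.zero_le_real.mpr (sub_nonneg.mpr ((hH.eigenvalues_le_maxEig i).trans h))
  · intro h
    rw [maxEig, dif_pos hH]
    refine ciSup_le fun i => ?_
    have hconj := h.conjTranspose_mul_mul_same (hH.eigenvectorUnitary : Matrix n n ℂ)
    rw [hH.smul_one_sub_eq, mul_assoc, mul_assoc, hH.conjTranspose_mul_eigenvectorUnitary,
      mul_one, ← mul_assoc, hH.conjTranspose_mul_eigenvectorUnitary, one_mul,
      posSemidef_diagonal_iff] at hconj
    exact sub_nonneg.mp (Complex.zero_le_real.mp (hconj i))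

theorem PosSemidef.maxEig_nonneg (hH : H.PosSemidef) : 0 ≤ maxEig H := by
  rw [maxEig, dif_pos hH.1]
  exact Real.iSup_nonneg hH.eigenvalues_nonneg

theorem maxEig_diagonal_le [Nonempty n] {d : n → ℝ} {c : ℝ} (hd : ∀ i, d i ≤ c) :
    maxEig (diagonal fun i => ((d i : ℝ) : ℂ)) ≤ c := by
  have hherm : (diagonal fun i => ((d i : ℝ) : ℂ)).IsHermitian :=
    isHermitian_diagonal_of_self_adjoint _ (funext fun i => Complex.conj_ofReal _)
  have hdiag : c • (1 : Matrix n n ℂ) - diagonal (fun i => ((d i : ℝ) : ℂ)) =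
      diagonal fun i => ((c - d i : ℝ) : ℂ) := by
    rw [← diagonal_one, ← diagonal_smul, diagonal_sub]
    congr 1
    ext i
    simp
  rw [hherm.maxEig_le_iff, hdiag]
  exact PosSemidef.diagonal fun i => Complex.zero_le_real.mpr (sub_nonneg.mpr (hd i))

theorem maxEig_sum_smul_le [Nonempty n] {ι : Type*} (s : Finset ι) (c : ι → ℝ)
    (hc : ∀ j ∈ s, 0 ≤ c j) (ρ : ι → Matrix n n ℂ) (hρ : ∀ j ∈ s, (ρ j).IsHermitian) :
    maxEig (∑ j ∈ s, c j • ρ j) ≤ ∑ j ∈ s, c j * maxEig (ρ j) := by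
  have hsum : (∑ j ∈ s, c j • ρ j).IsHermitian := by
    rw [IsHermitian, conjTranspose_sum]
    refine Finset.sum_congr rfl fun j hj => ?_
    rw [conjTranspose_smul, (hρ j hj).eq, star_trivial]
  rw [hsum.maxEig_le_iff, Finset.sum_smul, ← Finset.sum_sub_distrib]
  refine posSemidef_sum s fun j hj => ?_
  rw [mul_smul, ← smul_sub]
  exact (((hρ j hj).maxEig_le_iff _).mp le_rfl).smul (hc j hj)

theorem PosSemidef.sum_norm_sq_row_le (hH : H.PosSemidef) (i : n) :
    ∑ k, ‖H i k‖ ^ 2 ≤ maxEig H * (H i i).re := by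
  set V : Matrix n n ℂ := (hH.1.eigenvectorUnitary : Matrix n n ℂ)
  have hpsd : (H * (maxEig H • (1 : Matrix n n ℂ) - H)).PosSemidef := by
    have heq : H * (maxEig H • (1 : Matrix n n ℂ) - H) =
        V * diagonal (fun k => ((hH.1.eigenvalues k * (maxEig H - hH.1.eigenvalues k) : ℝ) : ℂ))
          * Vᴴ := by
      rw [hH.1.smul_one_sub_eq]
      nth_rw 1 [hH.1.eq_mul_diagonal_mul_conjTranspose]
      calc _ = V * (diagonal (fun k => ((hH.1.eigenvalues k : ℝ) : ℂ)) * (Vᴴ * V) *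
            diagonal (fun k => ((maxEig H - hH.1.eigenvalues k : ℝ) : ℂ))) * Vᴴ := by
            simp only [mul_assoc, V]
        _ = _ := by
            rw [hH.1.conjTranspose_mul_eigenvectorUnitary, mul_one, diagonal_mul_diagonal]
            simp only [Complex.ofReal_mul]
    rw [heq]
    refine (PosSemidef.diagonal fun k => ?_).mul_mul_conjTranspose_same _
    exact Complex.zero_le_real.mpr (mul_nonneg (hH.eigenvalues_nonneg k)
      (sub_nonneg.mpr (hH.1.eigenvalues_le_maxEig k)))
  have hdiag := (Complex.le_def.mp (hpsd.diag_nonneg (i := i))).1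
  have hsq : (H * H) i i = ((∑ k, ‖H i k‖ ^ 2 : ℝ) : ℂ) := by
    rw [mul_apply]
    push_cast
    refine Finset.sum_congr rfl fun k _ => ?_
    rw [← hH.1.apply k i, Complex.star_def, Complex.mul_conj']
  rw [mul_sub, Matrix.mul_smul, mul_one, sub_apply, hsq, smul_apply] at hdiag
  simp only [Complex.zero_re, Complex.sub_re, Complex.smul_re, Complex.ofReal_re, smul_eq_mul]
    at hdiag
  linarith

theorem sum_norm_sq_mulVec_of_conjTranspose_mul_self {m : Type*} [Fintype m] {U : Matrix m n ℂ}
    (hU : Uᴴ * U = 1) (v : n → ℂ) : ∑ x, ‖(U *ᵥ v) x‖ ^ 2 = ∑ x, ‖v x‖ ^ 2 := by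
  have hcast : ((∑ x, ‖(U *ᵥ v) x‖ ^ 2 : ℝ) : ℂ) = ((∑ x, ‖v x‖ ^ 2 : ℝ) : ℂ) := by
    rw [Complex.ofReal_sum, Complex.ofReal_sum]
    have h1 : ∑ x, ((‖(U *ᵥ v) x‖ ^ 2 : ℝ) : ℂ) = star (U *ᵥ v) ⬝ᵥ (U *ᵥ v) :=
      Finset.sum_congr rfl fun x _ => by
        rw [Complex.ofReal_pow]; exact (Complex.conj_mul' _).symm
    have h2 : ∑ x, ((‖v x‖ ^ 2 : ℝ) : ℂ) = star v ⬝ᵥ v :=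
      Finset.sum_congr rfl fun x _ => by
        rw [Complex.ofReal_pow]; exact (Complex.conj_mul' _).symm
    rw [h1, h2, star_mulVec, dotProduct_mulVec, vecMul_vecMul, hU, vecMul_one]
  exact_mod_cast hcast

end Matrix

section Swapping

open scoped ComplexOrder

variable {n m l : Type*} [Fintype m] [Fintype l]

theorem sum_norm_sq_isometry_apply_basis_tensor [Fintype n] [DecidableEq n] [DecidableEq m]
    {U : Matrix (n × m) (n × m) ℂ} (hU : Uᴴ * U = 1) (b : m × l → ℂ) (k : n) :
    ∑ i, ∑ cd : m × l, ‖∑ y, U (i, cd.1) (k, y) * b (y, cd.2)‖ ^ 2 = ∑ x, ‖b x‖ ^ 2 := by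
  have hcol : ∀ d : l, ∑ i, ∑ c, ‖∑ y, U (i, c) (k, y) * b (y, d)‖ ^ 2 =
      ∑ y, ‖b (y, d)‖ ^ 2 := by
    intro d
    have h := sum_norm_sq_mulVec_of_conjTranspose_mul_self hU
      (fun x : n × m => if x.1 = k then b (x.2, d) else 0)
    rw [Fintype.sum_prod_type, Fintype.sum_prod_type_right] at h
    simpa [mulVec, dotProduct, Fintype.sum_prod_type_right, apply_ite] using h
  calc _ = ∑ d, ∑ i, ∑ c, ‖∑ y, U (i, c) (k, y) * b (y, d)‖ ^ 2 := by
        rw [Finset.sum_comm (s := (Finset.univ : Finset l))]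
        exact Finset.sum_congr rfl fun i _ => Fintype.sum_prod_type_right _
    _ = _ := by
        simp only [hcol]
        rw [Fintype.sum_prod_type, Finset.sum_comm]

/-- The unnormalized reduced state of `∑ k, √(lam k) |k⟩ ⊗ χ k` on its first factor. -/
noncomputable def weightedGram (lam : n → ℝ) (χ : n → m → ℂ) : Matrix n n ℂ :=
  Matrix.of fun k k' => ((√(lam k) * √(lam k') : ℝ) : ℂ) *
    ∑ x, χ k x * (starRingEnd ℂ) (χ k' x)

theorem weightedGram_posSemidef [Fintype n] (lam : n → ℝ) (χ : n → m → ℂ) :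
    (weightedGram lam χ).PosSemidef := by
  convert posSemidef_self_mul_conjTranspose
    (Matrix.of fun k x => ((√(lam k) : ℝ) : ℂ) * χ k x) using 1
  ext k k'
  simp only [weightedGram, of_apply, mul_apply, conjTranspose_apply, Finset.mul_sum,
    Complex.ofReal_mul, star_mul', Complex.star_def, Complex.conj_ofReal]
  exact Finset.sum_congr rfl fun x _ => by ring

theorem weightedGram_smul_posSemidef [Fintype n] (lam : n → ℝ) (χ : n → m → ℂ) {c : ℝ}
    (hc : 0 ≤ c) : (c • weightedGram lam χ).PosSemidef :=
  (weightedGram_posSemidef lam χ).smul hc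

theorem weightedGram_apply_self {lam : n → ℝ} (hlam : ∀ k, 0 ≤ lam k) (χ : n → m → ℂ) (k : n) :
    weightedGram lam χ k k = ((lam k * ∑ x, ‖χ k x‖ ^ 2 : ℝ) : ℂ) := by
  rw [weightedGram, of_apply, Real.mul_self_sqrt (hlam k), Complex.ofReal_mul,
    Complex.ofReal_sum]
  simp only [Complex.mul_conj', Complex.ofReal_pow]

theorem norm_sq_weightedGram_apply {lam : n → ℝ} (hlam : ∀ k, 0 ≤ lam k) (χ : n → m → ℂ)
    (k k' : n) : ‖weightedGram lam χ k k'‖ ^ 2 =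
      lam k * lam k' * ‖∑ x, (starRingEnd ℂ) (χ k x) * χ k' x‖ ^ 2 := by
  have hconj : ∑ x, χ k x * (starRingEnd ℂ) (χ k' x) =
      (starRingEnd ℂ) (∑ x, (starRingEnd ℂ) (χ k x) * χ k' x) := by
    simp [map_sum]
  rw [weightedGram, of_apply, hconj, norm_mul, RCLike.norm_conj, Complex.norm_real,
    Real.norm_eq_abs, mul_pow, sq_abs, mul_pow, Real.sq_sqrt (hlam k), Real.sq_sqrt (hlam k')]

theorem weightedGram_eq_zero [Fintype n] {lam : n → ℝ} (hlam : ∀ k, 0 ≤ lam k) {χ : n → m → ℂ}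
    (h : ∑ k, lam k * ∑ x, ‖χ k x‖ ^ 2 = 0) : weightedGram lam χ = 0 := by
  have hterm : ∀ k, lam k * ∑ x, ‖χ k x‖ ^ 2 = 0 := fun k =>
    (Finset.sum_eq_zero_iff_of_nonneg fun k _ =>
      mul_nonneg (hlam k) (Finset.sum_nonneg fun x _ => sq_nonneg ‖χ k x‖)).mp h k
        (Finset.mem_univ k)
  ext k k'
  rcases mul_eq_zero.mp (hterm k) with hk | hk
  · simp [weightedGram, hk]
  · have hχ : ∀ x, χ k x = 0 := fun x => by
      simpa using (Finset.sum_eq_zero_iff_of_nonneg fun x _ => sq_nonneg ‖χ k x‖).mp hk x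
        (Finset.mem_univ x)
    simp [weightedGram, hχ]

theorem sum_weightedGram (lam : n → ℝ) (χ : m → n → l → ℂ) :
    ∑ j, weightedGram lam (χ j) = weightedGram lam fun k (jx : m × l) => χ jx.1 k jx.2 := by
  ext k k'
  simp only [Matrix.sum_apply, weightedGram, of_apply, Fintype.sum_prod_type, Finset.mul_sum]

/-- If the vectors `φ k` pairwise have squared overlap at least `ε`, each weight `lam k * ‖φ k‖²`
gives a lower bound for the largest eigenvalue of their weighted Gram matrix. -/
theorem lower_bound_maxEig_weightedGram [Fintype n] [DecidableEq n] {lam : n → ℝ}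
    (hlam : ∀ k, 0 ≤ lam k) {φ : n → m → ℂ} {q : n → ℝ} (hq : ∀ k, q k = ∑ x, ‖φ k x‖ ^ 2) {p : ℝ}
    (hp : p = ∑ k, lam k * q k) (hp0 : 0 < p) {ε : ℝ} (hε1 : ε ≤ 1)
    (hover : ∀ k k', 0 < q k → 0 < q k' →
      ε ≤ ‖∑ x, (starRingEnd ℂ) (φ k x) * φ k' x‖ ^ 2 / (q k * q k')) (k : n) :
    (1 - ε) * (lam k * q k) + ε * p ≤ p * maxEig (p⁻¹ • weightedGram lam φ) := by
  have hq0 : ∀ k, 0 ≤ q k := fun k => by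
    rw [hq]; exact Finset.sum_nonneg fun x _ => sq_nonneg _
  have hw0 : ∀ k, 0 ≤ lam k * q k := fun k => mul_nonneg (hlam k) (hq0 k)
  have hpos : ∀ k, 0 < lam k * q k →
      (1 - ε) * (lam k * q k) + ε * p ≤ p * maxEig (p⁻¹ • weightedGram lam φ) := by
    intro k hk
    have hrow := (weightedGram_smul_posSemidef lam φ
      (inv_nonneg.mpr hp0.le)).sum_norm_sq_row_le k
    have hdiag : weightedGram lam φ k k = ((lam k * q k : ℝ) : ℂ) := by
      rw [weightedGram_apply_self hlam, hq]
    simp only [Matrix.smul_apply, norm_smul, mul_pow, ← Finset.mul_sum, hdiag, Complex.smul_re,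
      Complex.ofReal_re, smul_eq_mul, norm_inv, Real.norm_eq_abs, abs_of_pos hp0] at hrow
    have hoff : ∀ k', ε * (lam k * q k) * (lam k' * q k') ≤ ‖weightedGram lam φ k k'‖ ^ 2 := by
      intro k'
      rw [norm_sq_weightedGram_apply hlam]
      have hqk : 0 < q k := pos_of_mul_pos_right hk (hlam k)
      rcases (hq0 k').eq_or_lt with h0 | hqk'
      · rw [← h0, mul_zero, mul_zero]
        exact mul_nonneg (mul_nonneg (hlam k) (hlam k')) (sq_nonneg _)
      · have h := (le_div_iff₀ (mul_pos hqk hqk')).mp (hover k k' hqk hqk')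
        calc _ = lam k * lam k' * (ε * (q k * q k')) := by ring
          _ ≤ _ := mul_le_mul_of_nonneg_left h (mul_nonneg (hlam k) (hlam k'))
    have hsum : (lam k * q k) * ((1 - ε) * (lam k * q k) + ε * p) ≤
        ∑ k', ‖weightedGram lam φ k k'‖ ^ 2 := by
      have hdiag_sq : ‖weightedGram lam φ k k‖ ^ 2 = (lam k * q k) ^ 2 := by
        rw [hdiag, Complex.norm_real, Real.norm_eq_abs, sq_abs]
      rw [← Finset.add_sum_erase _ _ (Finset.mem_univ k), hdiag_sq, hp,
        ← Finset.add_sum_erase _ (fun k => lam k * q k) (Finset.mem_univ k)]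
      have h := Finset.sum_le_sum fun k' (_ : k' ∈ Finset.univ.erase k) => hoff k'
      rw [← Finset.mul_sum] at h
      linarith
    have hrow' : ∑ k', ‖weightedGram lam φ k k'‖ ^ 2 ≤
        (lam k * q k) * (p * maxEig (p⁻¹ • weightedGram lam φ)) := by
      calc _ = p ^ 2 * (p⁻¹ ^ 2 * ∑ k', ‖weightedGram lam φ k k'‖ ^ 2) := by
            field_simp
        _ ≤ p ^ 2 * (maxEig (p⁻¹ • weightedGram lam φ) * (p⁻¹ * (lam k * q k))) :=
            mul_le_mul_of_nonneg_left hrow (sq_nonneg p)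
        _ = _ := by field_simp
    exact le_of_mul_le_mul_left (hsum.trans hrow') hk
  rcases (hw0 k).eq_or_lt with h0 | hk
  · obtain ⟨k', -, hk'⟩ := Finset.exists_lt_of_sum_lt (s := Finset.univ) (f := fun _ : n => (0 : ℝ))
      (g := fun k => lam k * q k) (by simpa [← hp] using hp0)
    have h := hpos k' hk'
    have h1 := mul_nonneg (sub_nonneg.mpr hε1) hk'.le
    rw [← h0]
    linarith
  · exact hpos k hk

end Swapping

/-- Imperfect entanglement swapping, measuring both middle registers B and C:
by convexity the expected largest eigenvalue of the reduced state on A still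
increases, ∑_{ij} p_{ij}·‖ρ_A^{(i,j)}‖_∞ ≥ ∑_i p_i·‖∑_j (p_{ij}/p_i)ρ_A^{(i,j)}‖_∞
≥ (1−ε)·‖ρ_A‖_∞ + ε. -/
theorem imperfect_swapping_topSchmidt_both_measured
    (d0 : ℕ) (hd0 : 2 ≤ d0) (ε : ℝ) (hε : 0 < ε)
    (lam : Fin d0 → ℝ) (hlam0 : ∀ k, 0 ≤ lam k) (hlam1 : ∑ k, lam k = 1)
    (b : Fin d0 × Fin d0 → ℂ) (hb : ∑ x : Fin d0 × Fin d0, ‖b x‖ ^ 2 = 1)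
    (U : Matrix (Fin d0 × Fin d0) (Fin d0 × Fin d0) ℂ) (hU : Uᴴ * U = 1)
    -- unnormalized post-measurement vectors φ̃_{i,k} on (C, D), after measuring B only
    (φt : Fin d0 → Fin d0 → Fin d0 × Fin d0 → ℂ)
    (hφt : ∀ i k : Fin d0, ∀ cd : Fin d0 × Fin d0,
      φt i k cd = ∑ yC : Fin d0, U (i, cd.1) (k, yC) * b (yC, cd.2))
    (q : Fin d0 → Fin d0 → ℝ)
    (hq : ∀ i k, q i k = ∑ cd : Fin d0 × Fin d0, ‖φt i k cd‖ ^ 2)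
    (p : Fin d0 → ℝ) (hp : ∀ i, p i = ∑ k, lam k * q i k)
    -- amplitudes χ_{i,j,k} on register D after measuring both B (outcome i) and C (outcome j)
    (χ : Fin d0 → Fin d0 → Fin d0 → Fin d0 → ℂ)
    (hχ : ∀ i j k xD : Fin d0, χ i j k xD = ∑ yC : Fin d0, U (i, j) (k, yC) * b (yC, xD))
    (p2 : Fin d0 → Fin d0 → ℝ)
    (hp2 : ∀ i j, p2 i j = ∑ k, lam k * ∑ xD : Fin d0, ‖χ i j k xD‖ ^ 2)
    -- normalized post-measurement reduced density matrices on A for outcomes (i,j)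
    (ρ2 : Fin d0 → Fin d0 → Matrix (Fin d0) (Fin d0) ℂ)
    (hρ2 : ∀ i j, ∀ k k' : Fin d0, ρ2 i j k k' =
      (((p2 i j)⁻¹ * Real.sqrt (lam k) * Real.sqrt (lam k') : ℝ) : ℂ) *
        ∑ xD : Fin d0, χ i j k xD * (starRingEnd ℂ) (χ i j k' xD))
    -- ε-imperfectness of the entanglement swapping
    (hover : ∀ i k k' : Fin d0, 0 < q i k → 0 < q i k' →
      ε ≤ ‖∑ cd : Fin d0 × Fin d0, (starRingEnd ℂ) (φt i k cd) * φt i k' cd‖ ^ 2 /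
            (q i k * q i k')) :
    (∑ i ∈ Finset.univ.filter (fun i : Fin d0 => 0 < p i),
        p i * maxEig (∑ j : Fin d0, (p2 i j / p i) • ρ2 i j) ≤
      ∑ ij ∈ Finset.univ.filter (fun ij : Fin d0 × Fin d0 => 0 < p2 ij.1 ij.2),
        p2 ij.1 ij.2 * maxEig (ρ2 ij.1 ij.2)) ∧
    ((1 - ε) * maxEig (Matrix.diagonal fun k => ((lam k : ℝ) : ℂ)) + ε ≤
      ∑ i ∈ Finset.univ.filter (fun i : Fin d0 => 0 < p i),
        p i * maxEig (∑ j : Fin d0, (p2 i j / p i) • ρ2 i j)) := by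
  have : Nonempty (Fin d0) := ⟨⟨0, by omega⟩⟩
  have hp20 : ∀ i j, 0 ≤ p2 i j := fun i j => by
    rw [hp2]
    exact Finset.sum_nonneg fun k _ =>
      mul_nonneg (hlam0 k) (Finset.sum_nonneg fun x _ => sq_nonneg _)
  have hρ2' : ∀ i j, ρ2 i j = (p2 i j)⁻¹ • weightedGram lam (χ i j) := by
    intro i j
    ext k k'
    rw [hρ2, Matrix.smul_apply, weightedGram, of_apply, Complex.real_smul, ← mul_assoc,
      ← Complex.ofReal_mul, mul_assoc (p2 i j)⁻¹]
  have hherm : ∀ i j, (ρ2 i j).IsHermitian := fun i j => by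
    rw [hρ2']
    exact (weightedGram_smul_posSemidef lam (χ i j) (inv_nonneg.mpr (hp20 i j))).1
  have hmax0 : ∀ i j, 0 ≤ maxEig (ρ2 i j) := fun i j => by
    rw [hρ2']
    exact (weightedGram_smul_posSemidef lam (χ i j) (inv_nonneg.mpr (hp20 i j))).maxEig_nonneg
  have hq0 : ∀ i k, 0 ≤ q i k := fun i k => by
    rw [hq]; exact Finset.sum_nonneg fun x _ => sq_nonneg _
  have hw0 : ∀ i k, 0 ≤ lam k * q i k := fun i k => mul_nonneg (hlam0 k) (hq0 i k)
  have hp0 : ∀ i, 0 ≤ p i := fun i => by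
    rw [hp]; exact Finset.sum_nonneg fun k _ => hw0 i k
  have hqsum : ∀ k, ∑ i, q i k = 1 := fun k => by
    simp only [hq, hφt]
    rw [sum_norm_sq_isometry_apply_basis_tensor hU, hb]
  have hpsum : ∑ i, p i = 1 := by
    simp only [hp]
    rw [Finset.sum_comm]
    simp only [← Finset.mul_sum, hqsum, mul_one, hlam1]
  have hε1 : ε ≤ 1 := by
    obtain ⟨i, -, hi⟩ := Finset.exists_lt_of_sum_lt (s := Finset.univ)
      (f := fun _ : Fin d0 => (0 : ℝ)) (g := fun i => q i (Classical.arbitrary (Fin d0)))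
      (by simp [hqsum])
    have h := hover i _ _ hi hi
    have hself : ∑ cd, (starRingEnd ℂ) (φt i (Classical.arbitrary (Fin d0)) cd) *
        φt i (Classical.arbitrary (Fin d0)) cd =
          ((q i (Classical.arbitrary (Fin d0)) : ℝ) : ℂ) := by
      rw [hq, Complex.ofReal_sum]
      simp only [Complex.conj_mul', Complex.ofReal_pow]
    rwa [hself, Complex.norm_real, Real.norm_eq_abs, sq_abs, ← pow_two,
      div_self (pow_pos hi 2).ne'] at h
  have havg : ∀ i, ∑ j, (p2 i j / p i) • ρ2 i j = (p i)⁻¹ • weightedGram lam (φt i) := by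
    intro i
    have hφ : φt i = fun k (jx : Fin d0 × Fin d0) => χ i jx.1 k jx.2 := by
      ext k cd; rw [hφt, hχ]
    rw [hφ, ← sum_weightedGram, Finset.smul_sum]
    refine Finset.sum_congr rfl fun j _ => ?_
    by_cases h0 : p2 i j = 0
    · rw [weightedGram_eq_zero hlam0 ((hp2 i j).symm.trans h0), h0]
      simp
    · rw [hρ2', smul_smul]
      congr 1
      field_simp
  constructor
  · calc _ ≤ ∑ i ∈ Finset.univ.filter (fun i : Fin d0 => 0 < p i),
          ∑ j, p2 i j * maxEig (ρ2 i j) := by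
          refine Finset.sum_le_sum fun i hi => ?_
          have hpi : 0 < p i := (Finset.mem_filter.mp hi).2
          refine (mul_le_mul_of_nonneg_left (maxEig_sum_smul_le Finset.univ _
            (fun j _ => div_nonneg (hp20 i j) hpi.le) (ρ2 i) fun j _ => hherm i j)
            hpi.le).trans_eq ?_
          rw [Finset.mul_sum]
          exact Finset.sum_congr rfl fun j _ => by field_simp
      _ ≤ ∑ i, ∑ j, p2 i j * maxEig (ρ2 i j) :=
          Finset.sum_le_sum_of_subset_of_nonneg (Finset.filter_subset _ _) fun i _ _ =>
            Finset.sum_nonneg fun j _ => mul_nonneg (hp20 i j) (hmax0 i j)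
      _ = ∑ ij : Fin d0 × Fin d0, p2 ij.1 ij.2 * maxEig (ρ2 ij.1 ij.2) :=
          (Fintype.sum_prod_type
            fun ij : Fin d0 × Fin d0 => p2 ij.1 ij.2 * maxEig (ρ2 ij.1 ij.2)).symm
      _ = _ := by
          refine (Finset.sum_filter_of_ne fun ij _ h => ?_).symm
          exact (hp20 _ _).lt_of_ne' (left_ne_zero_of_mul h)
  · obtain ⟨k, hk⟩ := Finite.exists_max lam
    calc _ ≤ (1 - ε) * lam k + ε := by
          have h := mul_le_mul_of_nonneg_left (maxEig_diagonal_le hk) (sub_nonneg.mpr hε1)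
          linarith
      _ = ∑ i, ((1 - ε) * (lam k * q i k) + ε * p i) := by
          rw [Finset.sum_add_distrib, ← Finset.mul_sum, ← Finset.mul_sum, ← Finset.mul_sum,
            hqsum, hpsum, mul_one, mul_one]
      _ = ∑ i ∈ Finset.univ.filter (fun i : Fin d0 => 0 < p i),
          ((1 - ε) * (lam k * q i k) + ε * p i) := by
          refine (Finset.sum_filter_of_ne fun i _ h => (hp0 i).lt_of_ne' fun h0 => h ?_).symm
          have hzero := (Finset.sum_eq_zero_iff_of_nonneg fun k _ => hw0 i k).mp
            ((hp i).symm.trans h0) k (Finset.mem_univ k)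
          rw [hzero, h0]
          ring
      _ ≤ _ := by
          refine Finset.sum_le_sum fun i hi => ?_
          rw [havg]
          exact lower_bound_maxEig_weightedGram hlam0 (hq i) (hp i) (Finset.mem_filter.mp hi).2
            hε1 (hover i) k
end

section
/- Let X₁,…,X_M be nonempty finite sets (M ≥ 3) and let p be a probability distribution on X₁×⋯×X_M. Suppose that for every k ∈ {1,…,M−2}, the conditional mutual information (in nats) between coordinate k and coordinates (k+2,…,M) given coordinate k+1 satisfies I(X_k : X_{k+2},…,X_M | X_{k+1}) ≤ ε. Define q : X₁×⋯×X_M → ℝ by q(x) := p_{M−1,M}(x_{M−1},x_M) · ∏_{k=1}^{M−2} [ p_{k,k+1}(x_k,x_{k+1}) / p_{k+1}(x_{k+1}) ], where p_{k,k+1} and p_{k+1} are the indicated marginals of p, and q(x) := 0 whenever some p_{k+1}(x_{k+1}) = 0. Then ∑_x |p(x) − q(x)| ≤ (M−2)·√(2ε). -/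
open Classical

/-- Conditional mutual information (in nats) I(A:C|B) of the distribution
induced by `p : Γ → ℝ` under the projections `fA, fB, fC`. -/
noncomputable def condMI {Γ α β γ : Type*} [Fintype Γ] [Fintype α] [Fintype β] [Fintype γ]
    (p : Γ → ℝ) (fA : Γ → α) (fB : Γ → β) (fC : Γ → γ) : ℝ :=
  ∑ a : α, ∑ b : β, ∑ c : γ,
    let pabc := ∑ g, if fA g = a ∧ fB g = b ∧ fC g = c then p g else 0
    let pb := ∑ g, if fB g = b then p g else 0
    let pab := ∑ g, if fA g = a ∧ fB g = b then p g else 0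
    let pbc := ∑ g, if fB g = b ∧ fC g = c then p g else 0
    if 0 < pabc then pabc * Real.log (pabc * pb / (pab * pbc)) else 0

/-- A rational lower bound for `log` which is sharp to third order at `1`. -/
lemma Real.rational_le_log {t : ℝ} (ht : 0 < t) :
    (t - 1) * (5 * t + 1) / (2 * t * (t + 2)) ≤ Real.log t := by
  set h : ℝ → ℝ := fun t => Real.log t - (t - 1) * (5 * t + 1) / (2 * t * (t + 2)) with hh
  have hd : ∀ s : ℝ, 0 < s → HasDerivAt h ((s - 1) ^ 3 / (s ^ 2 * (s + 2) ^ 2)) s := by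
    intro s hs
    have h1 : HasDerivAt (fun t : ℝ => (t - 1) * (5 * t + 1))
        (1 * (5 * s + 1) + (s - 1) * (5 * 1)) s :=
      ((hasDerivAt_id s).sub_const 1).mul (((hasDerivAt_id s).const_mul 5).add_const 1)
    have h2 : HasDerivAt (fun t : ℝ => (2 * t) * (t + 2))
        ((2 * 1) * (s + 2) + (2 * s) * 1) s :=
      ((hasDerivAt_id s).const_mul 2).mul ((hasDerivAt_id s).add_const 2)
    have h3 := (Real.hasDerivAt_log hs.ne').sub (h1.div h2 (by positivity))
    refine h3.congr_deriv ?_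
    field_simp
    ring
  have hc : ∀ s : ℝ, 0 < s → ContinuousAt h s := fun s hs => (hd s hs).continuousAt
  have h1 : h 1 = 0 := by simp [hh]
  suffices 0 ≤ h t by simpa [hh] using this
  rw [← h1]
  rcases le_total t 1 with h | h
  · refine antitoneOn_of_deriv_nonpos (convex_Icc t 1)
      (fun s hs => (hc s (ht.trans_le hs.1)).continuousWithinAt) ?_ ?_
      (Set.left_mem_Icc.2 h) (Set.right_mem_Icc.2 h) h
    · intro s hs
      rw [interior_Icc] at hs
      exact (hd s (ht.trans hs.1)).differentiableAt.differentiableWithinAt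
    · intro s hs
      rw [interior_Icc] at hs
      rw [(hd s (ht.trans hs.1)).deriv]
      refine div_nonpos_of_nonpos_of_nonneg ?_ (by positivity)
      exact Odd.pow_nonpos (by decide) (by linarith [hs.2])
  · refine monotoneOn_of_deriv_nonneg (convex_Icc 1 t)
      (fun s hs => (hc s (zero_lt_one.trans_le hs.1)).continuousWithinAt) ?_ ?_
      (Set.left_mem_Icc.2 h) (Set.right_mem_Icc.2 h) h
    · intro s hs
      rw [interior_Icc] at hs
      exact (hd s (zero_lt_one.trans hs.1)).differentiableAt.differentiableWithinAt
    · intro s hs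
      rw [interior_Icc] at hs
      rw [(hd s (zero_lt_one.trans hs.1)).deriv]
      exact div_nonneg (pow_nonneg (by linarith [hs.1]) 3) (by positivity)

lemma sq_sub_le_mul_log_div {P Q : ℝ} (hP : 0 ≤ P) (hQ : 0 ≤ Q) (hPQ : Q = 0 → P = 0) :
    (P - Q) ^ 2 ≤ (2 * P + 4 * Q) / 3 * (P * Real.log (P / Q) - P + Q) := by
  rcases hQ.eq_or_lt with h | hQ
  · simp [hPQ h.symm, ← h]
  rcases hP.eq_or_lt with h | hP
  · subst h
    simp only [zero_mul, zero_div]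
    nlinarith [sq_nonneg Q]
  have h := mul_le_mul_of_nonneg_left (Real.rational_le_log (div_pos hP hQ)) hP.le
  have e : P * ((P / Q - 1) * (5 * (P / Q) + 1) / (2 * (P / Q) * (P / Q + 2)))
      = (P - Q) * (5 * P + Q) / (2 * (P + 2 * Q)) := by
    field_simp
  rw [e] at h
  calc (P - Q) ^ 2 = (2 * P + 4 * Q) / 3 *
        ((P - Q) * (5 * P + Q) / (2 * (P + 2 * Q)) - P + Q) := by
        field_simp
        ring
    _ ≤ _ := by gcongr

/-- Pinsker's inequality for finitely supported probability distributions. -/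
lemma pinsker {ι : Type*} [Fintype ι] (P Q : ι → ℝ) (hP : ∀ i, 0 ≤ P i) (hQ : ∀ i, 0 ≤ Q i)
    (hPQ : ∀ i, Q i = 0 → P i = 0) (hP1 : ∑ i, P i = 1) (hQ1 : ∑ i, Q i = 1) :
    ∑ i, |P i - Q i| ≤ √(2 * ∑ i, P i * Real.log (P i / Q i)) := by
  apply Real.le_sqrt_of_sq_le
  have hpt := fun i => sq_sub_le_mul_log_div (hP i) (hQ i) (hPQ i)
  have hφ : ∀ i, 0 ≤ P i * Real.log (P i / Q i) - P i + Q i := by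
    intro i
    rcases (hQ i).eq_or_lt with h | h
    · simp [hPQ i h.symm, ← h]
    · exact nonneg_of_mul_nonneg_right ((sq_nonneg _).trans (hpt i))
        (by linarith [hP i])
  have hcs := Finset.sum_sq_le_sum_mul_sum_of_sq_le_mul Finset.univ
    (r := fun i => |P i - Q i|) (f := fun i => (2 * P i + 4 * Q i) / 3)
    (g := fun i => P i * Real.log (P i / Q i) - P i + Q i)
    (fun i _ => by linarith [hP i, hQ i]) (fun i _ => hφ i)
    (fun i _ => by rw [sq_abs]; exact hpt i)
  refine hcs.trans_eq ?_
  rw [← Finset.sum_div, Finset.sum_add_distrib, Finset.sum_add_distrib, Finset.sum_sub_distrib,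
    ← Finset.mul_sum, ← Finset.mul_sum, hP1, hQ1]
  ring

/-- The mass that `p` gives to the event `S`. -/
noncomputable def massOf {Γ : Type*} [Fintype Γ] (p : Γ → ℝ) (S : Γ → Prop) : ℝ :=
  ∑ g, if S g then p g else 0

section Mass

variable {Γ Γ' α β γ γ' : Type*} [Fintype Γ] [Fintype Γ'] [Fintype α] [Fintype β] [Fintype γ]
  [Fintype γ']

lemma massOf_nonneg {p : Γ → ℝ} (hp : ∀ g, 0 ≤ p g) (S : Γ → Prop) : 0 ≤ massOf p S :=
  Finset.sum_nonneg fun g _ => by split_ifs <;> simp [hp]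

lemma massOf_mono {p : Γ → ℝ} (hp : ∀ g, 0 ≤ p g) {S T : Γ → Prop} (h : ∀ g, S g → T g) :
    massOf p S ≤ massOf p T := by
  refine Finset.sum_le_sum fun g _ => ?_
  by_cases hS : S g
  · simp [hS, h g hS]
  · rw [if_neg hS]
    split_ifs <;> simp [hp]

lemma massOf_congr (p : Γ → ℝ) {S T : Γ → Prop} (h : ∀ g, S g ↔ T g) :
    massOf p S = massOf p T := by
  rw [funext fun g => propext (h g)]

lemma massOf_eq (p : Γ → ℝ) (x : Γ) : massOf p (fun g => g = x) = p x := by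
  simp [massOf]

lemma sum_massOf_and (p : Γ → ℝ) (f : Γ → α) (S : Γ → Prop) :
    ∑ a, massOf p (fun g => f g = a ∧ S g) = massOf p S := by
  unfold massOf
  rw [Finset.sum_comm]
  refine Finset.sum_congr rfl fun g _ => ?_
  by_cases h : S g <;> simp [h]

lemma sum_massOf (p : Γ → ℝ) (f : Γ → α) : ∑ a, massOf p (fun g => f g = a) = ∑ g, p g := by
  unfold massOf
  rw [Finset.sum_comm]
  simp

lemma condMI_eq (p : Γ → ℝ) (fA : Γ → α) (fB : Γ → β) (fC : Γ → γ) :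
    condMI p fA fB fC = ∑ a, ∑ b, ∑ c,
      if 0 < massOf p (fun g => fA g = a ∧ fB g = b ∧ fC g = c) then
        massOf p (fun g => fA g = a ∧ fB g = b ∧ fC g = c) *
          Real.log (massOf p (fun g => fA g = a ∧ fB g = b ∧ fC g = c) *
            massOf p (fun g => fB g = b) /
            (massOf p (fun g => fA g = a ∧ fB g = b) *
              massOf p (fun g => fB g = b ∧ fC g = c)))
      else 0 := by
  unfold condMI massOf
  congr! with a _ b _ c _

lemma condMI_comp_equiv (p : Γ → ℝ) (fA : Γ → α) (fB : Γ → β) (fC : Γ → γ) (e : γ ≃ γ') :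
    condMI p fA fB (fun g => e (fC g)) = condMI p fA fB fC := by
  simp only [condMI_eq]
  refine Finset.sum_congr rfl fun a _ => Finset.sum_congr rfl fun b _ => ?_
  rw [← Equiv.sum_comp e]
  simp only [EmbeddingLike.apply_eq_iff_eq]

lemma condMI_of_massOf_comp (p : Γ → ℝ) (p' : Γ' → ℝ) (π : Γ → Γ')
    (h : ∀ S : Γ' → Prop, massOf p' S = massOf p (fun g => S (π g)))
    (fA : Γ' → α) (fB : Γ' → β) (fC : Γ' → γ) :
    condMI p' fA fB fC =
      condMI p (fun g => fA (π g)) (fun g => fB (π g)) (fun g => fC (π g)) := by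
  simp only [condMI_eq, h]

lemma sum_abs_sub_le_sqrt_condMI {p : Γ → ℝ} (hp : ∀ g, 0 ≤ p g) (hp1 : ∑ g, p g = 1)
    (fA : Γ → α) (fB : Γ → β) (fC : Γ → γ) :
    ∑ i : α × β × γ, |massOf p (fun g => fA g = i.1 ∧ fB g = i.2.1 ∧ fC g = i.2.2) -
        massOf p (fun g => fA g = i.1 ∧ fB g = i.2.1) / massOf p (fun g => fB g = i.2.1) *
          massOf p (fun g => fB g = i.2.1 ∧ fC g = i.2.2)| ≤
      √(2 * condMI p fA fB fC) := by
  set P : α × β × γ → ℝ := fun i =>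
    massOf p (fun g => fA g = i.1 ∧ fB g = i.2.1 ∧ fC g = i.2.2) with hPdef
  set Q : α × β × γ → ℝ := fun i =>
    massOf p (fun g => fA g = i.1 ∧ fB g = i.2.1) / massOf p (fun g => fB g = i.2.1) *
      massOf p (fun g => fB g = i.2.1 ∧ fC g = i.2.2) with hQdef
  have hP0 : ∀ i, 0 ≤ P i := fun i => massOf_nonneg hp _
  have hQ0 : ∀ i, 0 ≤ Q i := fun i =>
    mul_nonneg (div_nonneg (massOf_nonneg hp _) (massOf_nonneg hp _)) (massOf_nonneg hp _)
  have hPQ : ∀ i, Q i = 0 → P i = 0 := by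
    intro i hi
    refine le_antisymm ?_ (hP0 i)
    simp only [hQdef, mul_eq_zero, div_eq_zero_iff] at hi
    rcases hi with (hi | hi) | hi <;> rw [← hi] <;> apply massOf_mono hp <;> tauto
  have hP1 : ∑ i, P i = 1 := by
    rw [Fintype.sum_prod_type_right, Fintype.sum_prod_type]
    simp only [hPdef, sum_massOf_and]
    rw [← hp1, ← sum_massOf p fB]
    refine Finset.sum_congr rfl fun b _ => ?_
    simp only [and_comm (a := fB _ = _), sum_massOf_and]
  have hQ1 : ∑ i, Q i = 1 := by
    rw [Fintype.sum_prod_type_right, Fintype.sum_prod_type]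
    simp only [hQdef, ← Finset.sum_mul, ← Finset.sum_div, sum_massOf_and, ← Finset.mul_sum]
    rw [← hp1, ← sum_massOf p fB]
    refine Finset.sum_congr rfl fun b _ => ?_
    simp only [and_comm (a := fB _ = _), sum_massOf_and]
    exact div_mul_cancel_of_imp id
  refine (pinsker P Q hP0 hQ0 hPQ hP1 hQ1).trans_eq ?_
  congr 2
  rw [condMI_eq, Fintype.sum_prod_type]
  refine Finset.sum_congr rfl fun a _ => ?_
  rw [Fintype.sum_prod_type]
  refine Finset.sum_congr rfl fun b _ => Finset.sum_congr rfl fun c _ => ?_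
  split_ifs with h
  · have hb : 0 < massOf p (fun g => fB g = b) := h.trans_le (massOf_mono hp (by tauto))
    simp only [hPdef, hQdef]
    congr 2
    rw [div_mul_eq_mul_div, div_div_eq_mul_div]
  · have : P (a, b, c) = 0 := le_antisymm (not_lt.1 h) (hP0 _)
    rw [this, zero_mul]

lemma sum_abs_sub_le_sqrt_condMI_of_injective {p : Γ → ℝ} (hp : ∀ g, 0 ≤ p g)
    (hp1 : ∑ g, p g = 1) (fA : Γ → α) (fB : Γ → β) (fC : Γ → γ)
    (hinj : Function.Injective fun g => (fA g, fB g, fC g)) :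
    ∑ x, |p x - massOf p (fun g => fA g = fA x ∧ fB g = fB x) /
        massOf p (fun g => fB g = fB x) * massOf p (fun g => fB g = fB x ∧ fC g = fC x)| ≤
      √(2 * condMI p fA fB fC) := by
  refine le_trans ?_ (sum_abs_sub_le_sqrt_condMI hp hp1 fA fB fC)
  refine le_trans (le_of_eq ?_) (Finset.sum_le_univ_sum_of_nonneg
    (s := Finset.univ.map ⟨_, hinj⟩) fun i => abs_nonneg _)
  rw [Finset.sum_map]
  refine Finset.sum_congr rfl fun x _ => ?_
  simp only [Function.Embedding.coeFn_mk]
  congr 2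
  rw [← massOf_eq p x]
  refine massOf_congr p fun g => ?_
  rw [← hinj.eq_iff]
  simp

end Mass

/-- The distribution of the coordinates `1, …, n` of a tuple distributed as `p`. -/
noncomputable def tailMarginal {n : ℕ} {X : Fin (n + 1) → Type*} [Fintype (X 0)]
    (p : (∀ j, X j) → ℝ) (t : ∀ j : Fin n, X j.succ) : ℝ :=
  ∑ a : X 0, p (Fin.cons a t)

lemma sum_eq_sum_cons {n : ℕ} {X : Fin (n + 1) → Type*} [∀ j, Fintype (X j)]
    (F : (∀ j, X j) → ℝ) :
    ∑ x, F x = ∑ t : (∀ j : Fin n, X j.succ), ∑ a : X 0, F (Fin.cons a t) := by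
  rw [← (Fin.consEquiv X).sum_comp, Fintype.sum_prod_type_right]
  rfl

lemma massOf_tailMarginal {n : ℕ} {X : Fin (n + 1) → Type*} [∀ j, Fintype (X j)]
    (p : (∀ j, X j) → ℝ) (S : (∀ j : Fin n, X j.succ) → Prop) :
    massOf (tailMarginal p) S = massOf p (fun g => S (Fin.tail g)) := by
  unfold massOf tailMarginal
  rw [sum_eq_sum_cons]
  refine Finset.sum_congr rfl fun t _ => ?_
  simp only [Fin.tail_cons]
  split_ifs <;> simp

/-- The Markov chain distribution with the same nearest-neighbour marginals as `p`. -/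
noncomputable def markovFactorization {m : ℕ} {X : Fin (m + 2) → Type*} [∀ j, Fintype (X j)]
    (p : (∀ j, X j) → ℝ) (x : ∀ j, X j) : ℝ :=
  massOf p (fun g => g ⟨m, by omega⟩ = x ⟨m, by omega⟩ ∧
      g (Fin.last (m + 1)) = x (Fin.last (m + 1))) *
    ∏ k : Fin m,
      (massOf p (fun g => g ⟨k.val, by omega⟩ = x ⟨k.val, by omega⟩ ∧
          g ⟨k.val + 1, by omega⟩ = x ⟨k.val + 1, by omega⟩) /
        massOf p (fun g => g ⟨k.val + 1, by omega⟩ = x ⟨k.val + 1, by omega⟩))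

lemma markovFactorization_succ {m : ℕ} {X : Fin (m + 3) → Type*} [∀ j, Fintype (X j)]
    (p : (∀ j, X j) → ℝ) (x : ∀ j, X j) :
    markovFactorization p x =
      massOf p (fun g => g 0 = x 0 ∧ g 1 = x 1) / massOf p (fun g => g 1 = x 1) *
        markovFactorization (tailMarginal p) (Fin.tail x) := by
  unfold markovFactorization
  rw [Fin.prod_univ_succ]
  simp only [massOf_tailMarginal]
  exact mul_left_comm _ _ _

lemma sum_abs_sub_markovFactorization_le (ε : ℝ) (m : ℕ) (X : Fin (m + 2) → Type*)
    [∀ j, Fintype (X j)] (p : (∀ j, X j) → ℝ) (hp0 : ∀ x, 0 ≤ p x) (hp1 : ∑ x, p x = 1)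
    (hCMI : ∀ k : Fin m,
      condMI p
        (fun g => g ⟨k.val, by omega⟩)
        (fun g => g ⟨k.val + 1, by omega⟩)
        (fun g => fun j : {j : Fin (m + 2) // k.val + 2 ≤ j.val} => g j.1) ≤ ε) :
    ∑ x, |p x - markovFactorization p x| ≤ m * √(2 * ε) := by
  induction m with
  | zero =>
    refine le_of_eq ?_
    simp only [Nat.cast_zero, zero_mul]
    refine Finset.sum_eq_zero fun x _ => ?_
    rw [abs_eq_zero, sub_eq_zero]
    simp only [markovFactorization, Finset.univ_eq_empty, Finset.prod_empty, mul_one]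
    rw [← massOf_eq p x]
    refine massOf_congr p fun g => ?_
    rw [funext_iff, Fin.forall_fin_two]
    rfl
  | succ m ih =>
    have htail : ∑ t, |tailMarginal p t - markovFactorization (tailMarginal p) t| ≤
        m * √(2 * ε) := by
      refine ih (fun j => X j.succ) (tailMarginal p)
        (fun t => Finset.sum_nonneg fun a _ => hp0 _) ?_ fun k => ?_
      · rw [← hp1]
        exact (sum_eq_sum_cons p).symm
      · refine le_trans (le_of_eq ?_) (hCMI k.succ)
        rw [condMI_of_massOf_comp p (tailMarginal p) Fin.tail (massOf_tailMarginal p)]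
        let e : {j : Fin (m + 2) // k.val + 2 ≤ j.val} ≃
            {j : Fin (m + 3) // k.succ.val + 2 ≤ j.val} :=
          { toFun := fun j => ⟨j.1.succ, by have := j.2; simp; omega⟩
            invFun := fun j => ⟨⟨j.1.val - 1, by have := j.2; simp at this; omega⟩,
              by have := j.2; simp at this; simp; omega⟩
            left_inv := fun j => by ext; simp
            right_inv := fun j => by have := j.2; simp at this; ext; simp; omega }
        exact condMI_comp_equiv p _ _
          (fun g => fun j : {j : Fin (m + 3) // k.succ.val + 2 ≤ j.val} => g j.1)
          (Equiv.piCongrLeft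
            (fun j : {j : Fin (m + 3) // k.succ.val + 2 ≤ j.val} => X j.1) e).symm
    set c : (∀ j, X j) → ℝ := fun x =>
      massOf p (fun g => g 0 = x 0 ∧ g 1 = x 1) / massOf p (fun g => g 1 = x 1) with hc
    have hc0 : ∀ x, 0 ≤ c x := fun x =>
      div_nonneg (massOf_nonneg hp0 _) (massOf_nonneg hp0 _)
    have hfirst : ∑ x, |p x - c x * tailMarginal p (Fin.tail x)| ≤ √(2 * ε) := by
      have hinj : Function.Injective fun g : (∀ j, X j) => (g 0, g 1,
          fun j : {j : Fin (m + 3) // 0 + 2 ≤ j.val} => g j.1) := by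
        intro g g' h
        simp only [Prod.mk.injEq] at h
        obtain ⟨h0, h1, h2⟩ := h
        funext j
        refine Fin.cases h0 (fun j => ?_) j
        refine Fin.cases h1 (fun j => ?_) j
        exact congrFun h2 ⟨j.succ.succ, by simp⟩
      refine le_trans (le_of_eq ?_)
        ((sum_abs_sub_le_sqrt_condMI_of_injective hp0 hp1 _ _ _ hinj).trans
          (Real.sqrt_le_sqrt (mul_le_mul_of_nonneg_left (hCMI 0) zero_le_two)))
      refine Finset.sum_congr rfl fun x _ => ?_
      simp only [hc]
      congr 3
      rw [← massOf_eq (tailMarginal p), massOf_tailMarginal]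
      refine massOf_congr p fun g => ⟨fun h => ⟨congrFun h 0, ?_⟩, fun ⟨h1, h2⟩ => ?_⟩
      · funext j
        obtain ⟨j, hj⟩ := j
        obtain ⟨i, rfl⟩ := Fin.exists_succ_eq.2 (show j ≠ 0 by rintro rfl; simp at hj)
        exact congrFun h i
      · funext j
        refine Fin.cases h1 (fun j => ?_) j
        exact congrFun h2 ⟨j.succ.succ, by simp⟩
    have hrest : ∑ x, c x * |tailMarginal p (Fin.tail x) -
        markovFactorization (tailMarginal p) (Fin.tail x)| ≤ m * √(2 * ε) := by
      refine le_trans ?_ htail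
      rw [sum_eq_sum_cons]
      refine Finset.sum_le_sum fun t _ => ?_
      simp only [Fin.tail_cons, ← Finset.sum_mul]
      refine mul_le_of_le_one_left (abs_nonneg _) ?_
      have h1 : ∀ a : X 0, (Fin.cons a t : ∀ j, X j) 1 = t 0 := fun a => rfl
      simp only [hc, Fin.cons_zero, h1, ← Finset.sum_div, sum_massOf_and]
      exact div_self_le_one _
    calc ∑ x, |p x - markovFactorization p x|
        ≤ ∑ x, (|p x - c x * tailMarginal p (Fin.tail x)| +
          c x * |tailMarginal p (Fin.tail x) -
            markovFactorization (tailMarginal p) (Fin.tail x)|) := by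
          refine Finset.sum_le_sum fun x _ => ?_
          rw [markovFactorization_succ, ← abs_of_nonneg (hc0 x), ← abs_mul,
            abs_of_nonneg (hc0 x)]
          refine le_of_eq_of_le ?_ (abs_add_le _ _)
          congr 1
          ring
      _ ≤ √(2 * ε) + m * √(2 * ε) := by
          rw [Finset.sum_add_distrib]
          exact add_le_add hfirst hrest
      _ = ((m + 1 : ℕ) : ℝ) * √(2 * ε) := by
          push_cast
          ring

/-- Markov-type factorization from small conditional mutual information
(M = m + 3 coordinates, 0-indexed; the 1-indexed coordinates k ∈ {1,…,M−2} of
the statement correspond to k : Fin (m+1) below).  If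
I(X_k : X_{k+2},…,X_M | X_{k+1}) ≤ ε for all such k, then the conditionally
factorized distribution q is (M−2)·√(2ε)-close to p in ℓ¹ distance. -/
theorem cmi_implies_factorization
    (m : ℕ) (X : Fin (m + 3) → Type) [∀ j, Fintype (X j)] [∀ j, Nonempty (X j)]
    (p : (∀ j, X j) → ℝ) (hp0 : ∀ x, 0 ≤ p x) (hp1 : ∑ x, p x = 1)
    (ε : ℝ)
    (hCMI : ∀ k : Fin (m + 1),
      condMI p
        (fun g => g ⟨k.val, by have := k.isLt; omega⟩)
        (fun g => g ⟨k.val + 1, by have := k.isLt; omega⟩)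
        (fun g => fun j : {j : Fin (m + 3) // k.val + 2 ≤ j.val} => g j.1) ≤ ε) :
    ∑ x : ∀ j, X j,
      |p x -
        (∑ g : ∀ j, X j, if g ⟨m + 1, by omega⟩ = x ⟨m + 1, by omega⟩ ∧
            g (Fin.last (m + 2)) = x (Fin.last (m + 2)) then p g else 0) *
          ∏ k : Fin (m + 1),
            ((∑ g : ∀ j, X j, if g ⟨k.val, by have := k.isLt; omega⟩ =
                  x ⟨k.val, by have := k.isLt; omega⟩ ∧
                g ⟨k.val + 1, by have := k.isLt; omega⟩ =
                  x ⟨k.val + 1, by have := k.isLt; omega⟩ then p g else 0) /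
             (∑ g : ∀ j, X j, if g ⟨k.val + 1, by have := k.isLt; omega⟩ =
                x ⟨k.val + 1, by have := k.isLt; omega⟩ then p g else 0))| ≤
      ((m + 3 : ℝ) - 2) * Real.sqrt (2 * ε) := by
  have h := sum_abs_sub_markovFactorization_le ε (m + 1) X p hp0 hp1 hCMI
  simp only [markovFactorization, massOf] at h
  convert h using 2
  · congr!
  · push_cast
    ring
end

section
/- Let A, B, C be nonempty finite sets and p a probability distribution on A×B×C. Then the overlap F := ∑_{(a,b,c) : p_B(b)>0} √( p(a,b,c) · p_{AB}(a,b) · p_{BC}(b,c) / p_B(b) ) satisfies F ≥ 1 − √( I(A:C|B) / 2 ), where I(A:C|B) is the conditional mutual information of p in nats. -/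
open Classical

/-- The pointwise estimate `√(p q) ≥ p - (p / 2) log (p / q)` with `q = u v / w`. -/
lemma sub_half_mul_log_le_sqrt {p u v w : ℝ} (hp : 0 < p) (hu : 0 < u) (hv : 0 < v)
    (hw : 0 < w) :
    p - p * Real.log (p * w / (u * v)) / 2 ≤ Real.sqrt (p * u * v / w) := by
  have hr : 0 < u * v / (p * w) := by positivity
  have hsqrt : Real.sqrt (p * u * v / w) = p * Real.sqrt (u * v / (p * w)) := by
    rw [show p * u * v / w = p ^ 2 * (u * v / (p * w)) by field_simp,
      Real.sqrt_mul (sq_nonneg p), Real.sqrt_sq hp.le]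
  have hlog : Real.log (p * w / (u * v)) = -Real.log (u * v / (p * w)) := by
    rw [← Real.log_inv, inv_div]
  have h := Real.log_le_sub_one_of_pos (Real.sqrt_pos.2 hr)
  rw [Real.log_sqrt hr.le] at h
  rw [hsqrt, hlog]
  nlinarith [mul_le_mul_of_nonneg_left h hp.le]

/-- For a nonnegative function, the value at a point bounds from below every sum of the
function over a set containing that point. -/
lemma le_sum_ite_of_nonneg {ι : Type*} [Fintype ι] {p : ι → ℝ} (hp : ∀ x, 0 ≤ p x)
    (P : ι → Prop) [DecidablePred P] {x : ι} (hx : P x) :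
    p x ≤ ∑ g, if P g then p g else 0 := by
  rw [← Finset.sum_filter]
  exact Finset.single_le_sum (fun g _ => hp g) (by simpa using hx)

/-- Overlap (fidelity-type) lower bound from small conditional mutual
information: F ≥ 1 − √(I(A:C|B)/2). -/
theorem overlap_ge_one_sub_sqrt_cmi
    (A B C : Type) [Fintype A] [Fintype B] [Fintype C]
    [Nonempty A] [Nonempty B] [Nonempty C]
    (p : A × B × C → ℝ) (hp0 : ∀ x, 0 ≤ p x) (hp1 : ∑ x, p x = 1) :
    1 - Real.sqrt (condMI p (fun x => x.1) (fun x => x.2.1) (fun x => x.2.2) / 2) ≤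
      ∑ x ∈ Finset.univ.filter
          (fun x : A × B × C => 0 < ∑ g : A × B × C, if g.2.1 = x.2.1 then p g else 0),
        Real.sqrt (p x * (∑ g : A × B × C, if g.1 = x.1 ∧ g.2.1 = x.2.1 then p g else 0) *
          (∑ g : A × B × C, if g.2.1 = x.2.1 ∧ g.2.2 = x.2.2 then p g else 0) /
          (∑ g : A × B × C, if g.2.1 = x.2.1 then p g else 0)) := by
  set pb : A × B × C → ℝ := fun x => ∑ g : A × B × C, if g.2.1 = x.2.1 then p g else 0 with hpb
  set pab : A × B × C → ℝ := fun x =>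
    ∑ g : A × B × C, if g.1 = x.1 ∧ g.2.1 = x.2.1 then p g else 0 with hpab
  set pbc : A × B × C → ℝ := fun x =>
    ∑ g : A × B × C, if g.2.1 = x.2.1 ∧ g.2.2 = x.2.2 then p g else 0 with hpbc
  set I := condMI p (fun x => x.1) (fun x => x.2.1) (fun x => x.2.2) with hI
  change _ ≤ ∑ x ∈ Finset.univ.filter (fun x => 0 < pb x),
    Real.sqrt (p x * pab x * pbc x / pb x)
  set F := ∑ x ∈ Finset.univ.filter (fun x => 0 < pb x),
    Real.sqrt (p x * pab x * pbc x / pb x) with hF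
  have hIsum : I = ∑ x, if 0 < p x then p x * Real.log (p x * pb x / (pab x * pbc x)) else 0 := by
    have hpoint : ∀ a b c,
        (∑ g : A × B × C, if g.1 = a ∧ g.2.1 = b ∧ g.2.2 = c then p g else 0) = p (a, b, c) := by
      intro a b c
      rw [Finset.sum_eq_single (a, b, c)]
      · simp
      · rintro ⟨a', b', c'⟩ _ hne
        exact if_neg fun h => hne (by simpa [Prod.ext_iff] using h)
      · simp
    simp only [hI, condMI, hpoint, Fintype.sum_prod_type, hpb, hpab, hpbc]
  have hF0 : 0 ≤ F := Finset.sum_nonneg fun x _ => Real.sqrt_nonneg _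
  have hlin : 1 - I / 2 ≤ F := by
    rw [hIsum, hF, Finset.sum_filter, ← hp1, Finset.sum_div, ← Finset.sum_sub_distrib]
    refine Finset.sum_le_sum fun x _ => ?_
    rcases (hp0 x).eq_or_lt with hx | hx
    · simp only [← hx, lt_irrefl, if_false, zero_div, sub_zero]
      split_ifs <;> first | exact Real.sqrt_nonneg _ | exact le_rfl
    · have hu : 0 < pab x := hx.trans_le (le_sum_ite_of_nonneg hp0 _ ⟨rfl, rfl⟩)
      have hv : 0 < pbc x := hx.trans_le (le_sum_ite_of_nonneg hp0 _ ⟨rfl, rfl⟩)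
      have hw : 0 < pb x := hx.trans_le (le_sum_ite_of_nonneg hp0 _ rfl)
      rw [if_pos hx, if_pos hw]
      exact sub_half_mul_log_le_sqrt hx hu hv hw
  rcases le_total 1 (I / 2) with h | h
  · linarith [Real.one_le_sqrt.2 h]
  · rcases le_total (I / 2) 0 with h0 | h0
    · linarith [Real.sqrt_nonneg (I / 2)]
    · linarith [Real.le_sqrt_of_sq_le (show (I / 2) ^ 2 ≤ I / 2 by nlinarith)]
end
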